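/- arXiv:1210.3556 — 12 statements merged into one kernel-verified Lean document; each statement's English description precedes it below -/
import Mathlib

section
/- Let Φ be a lift of an orientation-preserving circle homeomorphism with rational rotation number ρ(Φ) = p/q (p ∈ ℤ, q ∈ ℕ, q ≥ 1). Then for every x ∈ ℝ the displacement sequence is asymptotically periodic with semi-period q: for every ε > 0 there exists N ∈ ℕ such that for all n > N and all k ∈ ℕ one has |η_{n+kq}(x) − η_n(x)| < ε. -/
open Filter

lemma aux_cauchy (F : ℕ → ℝ) (q : ℕ) (C : ℝ) (hC : ∀ n, F n ≤ C) (hF : ∀ n, F n ≤ F (n + q))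
    (δ : ℝ) (hδ : 0 < δ) : ∃ N : ℕ, ∀ n, N ≤ n → ∀ k : ℕ, |F (n + k * q) - F n| < δ := by
  set S : ℕ → ℝ := fun n => ∑ r ∈ Finset.range q, F (n + r) with hS
  have hstep : ∀ n, S (n + 1) = S n + (F (n + q) - F n) := by
    intro n
    have h1 := Finset.sum_range_succ (fun r => F (n + r)) q
    have h2 := Finset.sum_range_succ' (fun r => F (n + r)) q
    have h3 : S (n + 1) = ∑ r ∈ Finset.range q, F (n + (r + 1)) := by
      simp only [hS]
      refine Finset.sum_congr rfl fun r _ => ?_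
      congr 1; ring
    simp only [add_zero] at h2
    rw [h3]; simp only [hS]; linarith
  have hmonoS : Monotone S := monotone_nat_of_le_succ fun n => by
    rw [hstep]; linarith [hF n]
  have hbdd : BddAbove (Set.range S) := by
    refine ⟨∑ r ∈ Finset.range q, C, ?_⟩
    rintro _ ⟨n, rfl⟩
    exact Finset.sum_le_sum fun r _ => hC _
  have hlim := tendsto_atTop_ciSup hmonoS hbdd
  obtain ⟨N, hN⟩ := Metric.cauchySeq_iff'.1 hlim.cauchySeq δ hδ
  refine ⟨N, fun n hn k => ?_⟩
  have key : 0 ≤ F (n + k * q) - F n ∧ F (n + k * q) - F n ≤ S (n + k * q) - S n := by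
    induction k with
    | zero => simp
    | succ k ih =>
      have e : n + (k + 1) * q = n + k * q + q := by ring
      rw [e]
      have h1 := hF (n + k * q)
      refine ⟨by linarith [ih.1], ?_⟩
      rcases Nat.eq_zero_or_pos q with h0 | h0
      · subst h0; simp
      · have h2 := hstep (n + k * q)
        have h3 : S (n + k * q + 1) ≤ S (n + k * q + q) := hmonoS (by omega)
        linarith [ih.2]
  rw [abs_of_nonneg key.1]
  have h1 := hN (n + k * q) (by have := Nat.zero_le (k * q); omega)
  rw [Real.dist_eq] at h1
  have h2 := hmonoS hn
  linarith [le_abs_self (S (n + k * q) - S N), key.2]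


/-- For a lift `Φ` of an orientation-preserving circle homeomorphism
with rational rotation number `p/q`, the displacement sequence
`η n x = Φ^[n] x - Φ^[n-1] x` is asymptotically periodic with semi-period `q`. -/
theorem displacement_asymptotically_periodic
    (Φ : ℝ → ℝ) (hcont : Continuous Φ) (hmono : StrictMono Φ)
    (hbij : Function.Bijective Φ) (hlift : ∀ x : ℝ, Φ (x + 1) = Φ x + 1)
    (p : ℤ) (q : ℕ) (hq : 1 ≤ q)
    (hrot : ∀ x : ℝ, Tendsto (fun n : ℕ => Φ^[n] x / n) atTop (nhds ((p : ℝ) / (q : ℝ))))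
    (x : ℝ) (ε : ℝ) (hε : 0 < ε) :
    ∃ N : ℕ, ∀ n : ℕ, n > N → ∀ k : ℕ,
      |(Φ^[n + k * q] x - Φ^[n + k * q - 1] x) - (Φ^[n] x - Φ^[n - 1] x)| < ε := by
  let f : CircleDeg1Lift := ⟨⟨Φ, hmono.monotone⟩, hlift⟩
  have hf : ⇑f = Φ := rfl
  have hτ : f.translationNumber = (p : ℝ) / q := by
    refine tendsto_nhds_unique (f.tendsto_translation_number₀) ?_
    have := hrot 0
    simpa only [CircleDeg1Lift.coe_pow, hf] using this
  have hq0 : (q : ℝ) ≠ 0 := by positivity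
  set F : ℕ → ℝ := fun n => Φ^[n] x - n * ((p : ℝ) / q) with hFdef
  have hbound : ∃ C, ∀ n, |F n| ≤ C := by
    refine ⟨1 + |(⌈x⌉ : ℝ)| + |(⌊x⌋ : ℝ)|, fun n => ?_⟩
    have h1 := f.dist_pow_map_zero_mul_translationNumber_le n
    have h2 := (f ^ n).map_le_of_map_zero x
    have h3 := (f ^ n).le_map_of_map_zero x
    rw [hτ, Real.dist_eq] at h1
    simp only [CircleDeg1Lift.coe_pow, hf] at h1 h2 h3
    rw [abs_le] at h1 ⊢
    simp only [hFdef]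
    constructor <;> linarith [le_abs_self (⌈x⌉ : ℝ), neg_abs_le (⌊x⌋ : ℝ),
      abs_nonneg (⌈x⌉ : ℝ), abs_nonneg (⌊x⌋ : ℝ), h1.1, h1.2]
  obtain ⟨C, hC⟩ := hbound
  have hFq : ∀ n, F (n + q) - F n = Φ^[n] (Φ^[q] x) - Φ^[n] (x + p) := by
    intro n
    have h := (f ^ n).map_add_int x p
    simp only [CircleDeg1Lift.coe_pow, hf] at h
    rw [h, ← Function.iterate_add_apply]
    simp only [hFdef]
    push_cast
    field_simp
    ring
  have hcauchy : ∀ δ : ℝ, 0 < δ →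
      ∃ N : ℕ, ∀ n, N ≤ n → ∀ k : ℕ, |F (n + k * q) - F n| < δ := by
    intro δ hδ
    rcases le_total (x + p) (Φ^[q] x) with h | h
    · refine aux_cauchy F q C (fun n => (le_abs_self _).trans (hC n)) (fun n => ?_) δ hδ
      have := hmono.monotone.iterate n h
      linarith [hFq n]
    · obtain ⟨N, hN⟩ := aux_cauchy (fun n => - F n) q C
        (fun n => (neg_le_abs _).trans (hC n)) (fun n => by
          have := hmono.monotone.iterate n h
          linarith [hFq n]) δ hδ
      refine ⟨N, fun n hn k => ?_⟩
      have := hN n hn k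
      rw [← abs_neg]
      convert this using 2
      ring
  obtain ⟨N, hN⟩ := hcauchy (ε / 2) (by linarith)
  refine ⟨N, fun n hn k => ?_⟩
  obtain ⟨m, rfl⟩ : ∃ m, n = m + 1 := ⟨n - 1, by omega⟩
  have h1 := hN (m + 1) (by omega) k
  have h2 := hN m (by omega) k
  have e1 : m + 1 + k * q - 1 = m + k * q := by omega
  have e2 : m + 1 - 1 = m := rfl
  rw [e1, e2]
  have e : (Φ^[m + 1 + k * q] x - Φ^[m + k * q] x) - (Φ^[m + 1] x - Φ^[m] x)
      = (F (m + 1 + k * q) - F (m + 1)) - (F (m + k * q) - F m) := by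
    simp only [hFdef]; push_cast; ring
  rw [e]
  rw [abs_lt] at *
  constructor <;> linarith [h1.1, h1.2, h2.1, h2.2]
end

section
/- Let Φ be a lift of an orientation-preserving circle homeomorphism with rotation number ρ(Φ) = p/q, and let x⁻ < x⁺ < x⁻ + 1 satisfy Φ^q(x⁻) = x⁻ + p and Φ^q(x⁺) = x⁺ + p, with no y ∈ (x⁻, x⁺) satisfying Φ^q(y) = y + p. Assume that for every y ∈ (x⁻, x⁺), Φ^{qn}(y) − np → x⁺ and Φ^{−qn}(y) + np → x⁻ as n → ∞. Fix ε > 0. Then there exists a point x̃ ∈ (x⁻, x⁺) (the ε-basins-shred) such that: (1) for every y ∈ [x̃, x⁺) and every n ∈ ℕ, if |Φ^{−nq−i}(y) + np − Φ^{−i}(x⁻)| < ε for all i = 0, 1, …, q−1, then |Φ^{nq+i}(y) − np − Φ^{i}(x⁺)| < ε for all i = 0, 1, …, q−1; and (2) for every y ∈ (x⁻, x̃] and every n ∈ ℕ, if |Φ^{nq+i}(y) − np − Φ^{i}(x⁺)| < ε for all i = 0, 1, …, q−1, then |Φ^{−nq−i}(y) + np − Φ^{−i}(x⁻)| < ε for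 all i = 0, 1, …, q−1. -/
open Filter Set


def DD (g : ℝ → ℝ) (q : ℕ) (w ε : ℝ) (n : ℕ) (y : ℝ) : Prop :=
  ∀ i : ℕ, i < q → |g^[n * q + i] y - g^[n * q + i] w| < ε

theorem iter_add_int (g : ℝ → ℝ) (hm : Monotone g) (hl : ∀ x : ℝ, g (x + 1) = g x + 1)
    (k : ℕ) (x : ℝ) (z : ℤ) : g^[k] (x + z) = g^[k] x + z := by
  let G : CircleDeg1Lift := ⟨⟨g, hm⟩, hl⟩
  have h := (G ^ k).map_add_int x z
  rw [CircleDeg1Lift.coe_pow] at h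
  exact h

theorem iter_sub_int (g : ℝ → ℝ) (hm : Monotone g) (hl : ∀ x : ℝ, g (x + 1) = g x + 1)
    (k : ℕ) (x : ℝ) (z : ℤ) : g^[k] (x - z) = g^[k] x - z := by
  have h := iter_add_int g hm hl k x (-z)
  push_cast at h
  simpa [sub_eq_add_neg] using h

theorem iter_f (g : ℝ → ℝ) (hm : Monotone g) (hl : ∀ x : ℝ, g (x + 1) = g x + 1)
    (q : ℕ) (c : ℤ) (n : ℕ) (y : ℝ) :
    (fun x => g^[q] x - (c : ℝ))^[n] y = g^[q * n] y - n * (c : ℝ) := by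
  induction n with
  | zero => simp
  | succ n ih =>
    rw [Function.iterate_succ_apply', ih]
    have h := iter_sub_int g hm hl q (g^[q * n] y) (n * c)
    push_cast at h
    rw [h, ← Function.iterate_add_apply, show q + q * n = q * (n + 1) by ring]
    push_cast
    ring

theorem fix_iter (g : ℝ → ℝ) (hm : Monotone g) (hl : ∀ x : ℝ, g (x + 1) = g x + 1)
    (q : ℕ) (c : ℤ) (w : ℝ) (hw : g^[q] w = w + c) (n i : ℕ) :
    g^[n * q + i] w = g^[i] w + n * (c : ℝ) := by
  have h1 : (fun x => g^[q] x - (c : ℝ))^[n] w = w :=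
    Function.iterate_fixed (by simp [hw]) n
  rw [iter_f g hm hl] at h1
  have h2 : g^[q * n] w = w + ((n * c : ℤ) : ℝ) := by push_cast; linarith
  rw [add_comm, Function.iterate_add_apply, mul_comm, h2, iter_add_int g hm hl]
  push_cast
  ring

theorem closer (g : ℝ → ℝ) (hm : Monotone g) (q : ℕ) (w ε : ℝ) (n : ℕ) (y y' : ℝ)
    (hy : y' ∈ uIcc y w) (h : DD g q w ε n y) : DD g q w ε n y' := by
  intro i hi
  refine lt_of_le_of_lt ?_ (h i hi)
  have := (hm.iterate (n * q + i)).mapsTo_uIcc hy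
  rw [abs_sub_comm _ (g^[n * q + i] w), abs_sub_comm _ (g^[n * q + i] w)]
  exact abs_sub_right_of_mem_uIcc this

theorem mem_uIcc_lim (f : ℝ → ℝ) (hf : Monotone f) (y w : ℝ)
    (h : Tendsto (fun n => f^[n] y) atTop (nhds w)) : f y ∈ uIcc y w := by
  rcases le_total y (f y) with h1 | h1
  · have := (hf.monotone_iterate_of_le_map h1).ge_of_tendsto h 1
    exact mem_uIcc_of_le h1 (by simpa using this)
  · have := (hf.antitone_iterate_of_map_le h1).le_of_tendsto h 1
    exact mem_uIcc_of_ge (by simpa using this) h1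

theorem oneside (g : ℝ → ℝ) (hc : Continuous g) (hs : StrictMono g)
    (hl : ∀ x : ℝ, g (x + 1) = g x + 1) (q : ℕ) (c : ℤ) (xm xp w ε : ℝ) (hlt : xm < xp)
    (hε : 0 < ε)
    (hxm : g^[q] xm = xm + c) (hxp : g^[q] xp = xp + c) (hw : g^[q] w = w + c)
    (ht : ∀ y ∈ Ioo xm xp,
      Tendsto (fun n : ℕ => g^[q * n] y - n * (c : ℝ)) atTop (nhds w))
    (A : ℕ → Set ℝ) (hA : ∀ n, A n = {y | y ∈ Ioo xm xp ∧ DD g q w ε n y}) :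
    (∀ n, IsOpen (A n)) ∧ (∀ n, A n ⊆ A (n + 1)) ∧ (∀ n, (A n).Nonempty) ∧
    (∀ n, (Ioo xm xp \ A n).Nonempty → (A (n + 1) \ A n).Nonempty) ∧
    (∀ y ∈ Ioo xm xp, ∀ᶠ n in atTop, y ∈ A n) := by
  have hm := hs.monotone
  set f : ℝ → ℝ := fun x => g^[q] x - (c : ℝ) with hf
  have hfm : StrictMono f := fun a b hab => sub_lt_sub_right (hs.iterate q hab) _
  have hfI : ∀ y ∈ Ioo xm xp, f y ∈ Ioo xm xp := by
    intro y hy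
    have h1 := hfm hy.1
    have h2 := hfm hy.2
    simp only [hf, hxm, hxp, add_sub_cancel_right] at h1 h2
    exact ⟨h1, h2⟩
  have ht' : ∀ y ∈ Ioo xm xp, Tendsto (fun n : ℕ => f^[n] y) atTop (nhds w) := by
    intro y hy
    simpa only [hf, iter_f g hm hl] using ht y hy
  have hDf : ∀ n y, DD g q w ε n (f y) ↔ DD g q w ε (n + 1) y := by
    intro n y
    refine forall_congr' fun i => imp_congr_right fun _ => ?_
    have e : (n + 1) * q + i = (n * q + i) + q := by ring
    rw [e, Function.iterate_add_apply _ _ q, Function.iterate_add_apply _ _ q, hw,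
      iter_add_int g hm hl]
    simp only [hf]
    rw [iter_sub_int g hm hl, sub_sub, add_comm (c : ℝ)]
  have hAf : ∀ n, ∀ y ∈ Ioo xm xp, (f y ∈ A n ↔ y ∈ A (n + 1)) := by
    intro n y hy
    rw [hA, hA]
    simp only [mem_ofPred_eq, hDf, hy, hfI y hy, true_and]
  have hAit : ∀ j n, ∀ y ∈ Ioo xm xp, (f^[j] y ∈ A n ↔ y ∈ A (n + j)) := by
    intro j
    induction j with
    | zero => intros; rfl
    | succ j ih =>
      intro n y hy
      rw [Function.iterate_succ_apply, ih n _ (hfI y hy), hAf _ y hy]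
      rfl
  have hitI : ∀ j, ∀ y ∈ Ioo xm xp, f^[j] y ∈ Ioo xm xp := fun j y hy =>
    (show MapsTo f (Ioo xm xp) (Ioo xm xp) from hfI).iterate j hy
  have hev : ∀ y ∈ Ioo xm xp, ∀ᶠ n in atTop, y ∈ A n := by
    intro y hy
    have : ∀ᶠ n : ℕ in atTop, ∀ i ∈ Finset.range q, |g^[n * q + i] y - g^[n * q + i] w| < ε := by
      rw [Filter.eventually_all_finset]
      intro i _
      have h1 : Tendsto (fun n : ℕ => g^[i] (f^[n] y)) atTop (nhds (g^[i] w)) :=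
        ((hc.iterate i).tendsto w).comp (ht' y hy)
      filter_upwards [Metric.tendsto_nhds.1 h1 ε hε] with n hn
      rw [Real.dist_eq, hf, iter_f g hm hl] at hn
      have h2 := iter_sub_int g hm hl i (g^[q * n] y) (n * c)
      push_cast at h2
      rw [h2, ← Function.iterate_add_apply] at hn
      rw [fix_iter g hm hl q c w hw, show n * q + i = i + q * n by ring]
      convert hn using 2
      ring
    filter_upwards [this] with n hn
    rw [hA]
    exact ⟨hy, fun i hi => hn i (Finset.mem_range.2 hi)⟩
  have hsub : ∀ n, A n ⊆ A (n + 1) := by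
    intro n y hy
    have hy' := hy
    rw [hA] at hy'
    rw [← hAf n y hy'.1, hA]
    exact ⟨hfI y hy'.1, closer g hm q w ε n y _
      (mem_uIcc_lim f hfm.monotone y w (ht' y hy'.1)) hy'.2⟩
  have hmo : Monotone A := monotone_nat_of_le_succ hsub
  have hreach : ∀ n, ∀ y ∈ Ioo xm xp, ∃ j, f^[j] y ∈ A n := by
    intro n y hy
    obtain ⟨j, hj⟩ := (hev y hy).exists
    exact ⟨j, (hAit j n y hy).2 (hmo (by omega) hj)⟩
  refine ⟨?_, hsub, ?_, ?_, hev⟩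
  · intro n
    have : A n = Ioo xm xp ∩ ⋂ i ∈ Finset.range q,
        {y | |g^[n * q + i] y - g^[n * q + i] w| < ε} := by
      rw [hA]; ext y; simp [DD]
    rw [this]
    refine isOpen_Ioo.inter (isOpen_biInter_finset fun i _ => ?_)
    exact isOpen_lt (((hc.iterate _).sub continuous_const).abs) continuous_const
  · intro n
    obtain ⟨y, hy⟩ := nonempty_Ioo.2 hlt
    obtain ⟨j, hj⟩ := hreach n y hy
    exact ⟨_, hj⟩
  · rintro n ⟨y, hy, hyn⟩
    classical
    have hex := hreach n y hy
    have h1 := Nat.find_spec hex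
    obtain ⟨j, hj⟩ : ∃ j, Nat.find hex = j + 1 := by
      refine Nat.exists_eq_succ_of_ne_zero fun h0 => hyn ?_
      rw [h0] at h1
      exact h1
    refine ⟨f^[j] y, ?_, Nat.find_min hex (by omega)⟩
    rw [hj, Function.iterate_succ_apply'] at h1
    exact (hAf n _ (hitI j y hy)).1 h1

theorem combine (xm xp : ℝ) (hlt : xm < xp) (A B : ℕ → Set ℝ)
    (hAI : ∀ n, A n ⊆ Ioo xm xp) (hBI : ∀ n, B n ⊆ Ioo xm xp)
    (hAu : ∀ n, ∀ y ∈ A n, ∀ z ∈ Ioo xm xp, y ≤ z → z ∈ A n)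
    (hBd : ∀ n, ∀ y ∈ B n, ∀ z ∈ Ioo xm xp, z ≤ y → z ∈ B n)
    (hA : (∀ n, IsOpen (A n)) ∧ (∀ n, A n ⊆ A (n + 1)) ∧ (∀ n, (A n).Nonempty) ∧
      (∀ n, (Ioo xm xp \ A n).Nonempty → (A (n + 1) \ A n).Nonempty) ∧
      (∀ y ∈ Ioo xm xp, ∀ᶠ n in atTop, y ∈ A n))
    (hB : (∀ n, IsOpen (B n)) ∧ (∀ n, B n ⊆ B (n + 1)) ∧ (∀ n, (B n).Nonempty) ∧
      (∀ n, (Ioo xm xp \ B n).Nonempty → (B (n + 1) \ B n).Nonempty) ∧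
      (∀ y ∈ Ioo xm xp, ∀ᶠ n in atTop, y ∈ B n)) :
    ∃ x ∈ Ioo xm xp, ∀ n, x ∈ A n ↔ x ∈ B n := by
  obtain ⟨Ao, As, An, Ad, Ae⟩ := hA
  obtain ⟨Bo, Bs, Bn, Bd, Be⟩ := hB
  have Am : Monotone A := monotone_nat_of_le_succ As
  have Bm : Monotone B := monotone_nat_of_le_succ Bs
  have hex : ∃ k, (A k ∩ B k).Nonempty := by
    obtain ⟨y, hy⟩ := nonempty_Ioo.2 hlt
    obtain ⟨k, hk⟩ := ((Ae y hy).and (Be y hy)).exists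
    exact ⟨k, y, hk⟩
  classical
  have hk := Nat.find_spec hex
  have hmin := fun m => @Nat.find_min _ _ hex m
  generalize Nat.find hex = k at hk hmin
  cases k with
  | zero =>
    obtain ⟨y, hyA, hyB⟩ := hk
    exact ⟨y, hAI _ hyA, fun n =>
      ⟨fun _ => Bm (Nat.zero_le n) hyB, fun _ => Am (Nat.zero_le n) hyA⟩⟩
  | succ m =>
    have hdisj : Disjoint (A m) (B m) := by
      rw [disjoint_iff_inter_eq_empty]
      exact not_nonempty_iff_eq_empty.1 (hmin m (by omega))
    have key : ∃ y ∈ A (m + 1) ∩ B (m + 1), y ∉ A m ∪ B m := by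
      by_contra! hcon
      have hpre : IsPreconnected (A (m + 1) ∩ B (m + 1)) := by
        apply Set.OrdConnected.isPreconnected
        refine ⟨fun a ha b hb z hz => ?_⟩
        have hzI : z ∈ Ioo xm xp :=
          ⟨(hAI _ ha.1).1.trans_le hz.1, hz.2.trans_lt (hAI _ hb.1).2⟩
        exact ⟨hAu _ a ha.1 z hzI hz.1, hBd _ b hb.2 z hzI hz.2⟩
      obtain ⟨w, hw⟩ := hk
      rcases hpre.subset_or_subset (Ao m) (Bo m) hdisj hcon with h | h
      · obtain ⟨b, hb⟩ := Bn m
        obtain ⟨z, hz, hz'⟩ := Ad m ⟨b, hBI _ hb, fun hb' => disjoint_left.1 hdisj hb' hb⟩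
        have hzw : z ≤ w := by
          by_contra! hc
          exact hz' (hAu m w (h hw) z (hAI _ hz) hc.le)
        exact hz' (h ⟨hz, hBd _ w hw.2 z (hAI _ hz) hzw⟩)
      · obtain ⟨b, hb⟩ := An m
        obtain ⟨z, hz, hz'⟩ := Bd m ⟨b, hAI _ hb, fun hb' => disjoint_left.1 hdisj hb hb'⟩
        have hzw : w ≤ z := by
          by_contra! hc
          exact hz' (hBd m w (h hw) z (hBI _ hz) hc.le)
        exact hz' (h ⟨hAu _ w hw.1 z (hBI _ hz) hzw, hz⟩)
    obtain ⟨y, ⟨hyA, hyB⟩, hy⟩ := key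
    refine ⟨y, hAI _ hyA, fun n => ?_⟩
    rcases Nat.lt_or_ge m n with hn | hn
    · exact ⟨fun _ => Bm hn hyB, fun _ => Am hn hyA⟩
    · exact ⟨fun h => absurd (Or.inl (Am hn h)) hy, fun h => absurd (Or.inr (Bm hn h)) hy⟩

/-- Existence of the `ε`-basins-shred between two consecutive
(lifts of) periodic points `x⁻ < x⁺` of a circle homeomorphism lift `Φ` with rotation
number `p/q`, where `x⁺` is attracting and `x⁻` is repelling on `(x⁻, x⁺)` under the
`q`-th iterate. `Φi` denotes the inverse of `Φ`. -/
theorem epsilon_basins_shred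
    (Φ Φi : ℝ → ℝ) (hcont : Continuous Φ) (hmono : StrictMono Φ)
    (hbij : Function.Bijective Φ) (hlift : ∀ x : ℝ, Φ (x + 1) = Φ x + 1)
    (hinv₁ : Function.LeftInverse Φi Φ) (hinv₂ : Function.RightInverse Φi Φ)
    (p : ℤ) (q : ℕ) (hq : 1 ≤ q)
    (hrot : ∀ x : ℝ, Tendsto (fun n : ℕ => Φ^[n] x / n) atTop (nhds ((p : ℝ) / (q : ℝ))))
    (xm xp : ℝ) (hlt : xm < xp) (hlt' : xp < xm + 1)
    (hxm : Φ^[q] xm = xm + p) (hxp : Φ^[q] xp = xp + p)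
    (hnofix : ∀ y ∈ Ioo xm xp, Φ^[q] y ≠ y + p)
    (hattr : ∀ y ∈ Ioo xm xp,
      Tendsto (fun n : ℕ => Φ^[q * n] y - n * (p : ℝ)) atTop (nhds xp))
    (hrep : ∀ y ∈ Ioo xm xp,
      Tendsto (fun n : ℕ => Φi^[q * n] y + n * (p : ℝ)) atTop (nhds xm))
    (ε : ℝ) (hε : 0 < ε) :
    ∃ xt ∈ Ioo xm xp,
      (∀ y ∈ Ico xt xp, ∀ n : ℕ,
        (∀ i : ℕ, i < q → |Φi^[n * q + i] y + n * (p : ℝ) - Φi^[i] xm| < ε) →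
        (∀ i : ℕ, i < q → |Φ^[n * q + i] y - n * (p : ℝ) - Φ^[i] xp| < ε)) ∧
      (∀ y ∈ Ioc xm xt, ∀ n : ℕ,
        (∀ i : ℕ, i < q → |Φ^[n * q + i] y - n * (p : ℝ) - Φ^[i] xp| < ε) →
        (∀ i : ℕ, i < q → |Φi^[n * q + i] y + n * (p : ℝ) - Φi^[i] xm| < ε)) := by
  have him : StrictMono Φi := by
    intro a b hab
    rw [← hmono.lt_iff_lt, hinv₂ a, hinv₂ b]
    exact hab
  have hic : Continuous Φi := him.monotone.continuous_of_surjective hinv₁.surjective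
  have hil : ∀ x : ℝ, Φi (x + 1) = Φi x + 1 := by
    intro x
    apply hmono.injective
    rw [hinv₂, hlift, hinv₂]
  have hifix : ∀ w : ℝ, Φ^[q] w = w + p → Φi^[q] w = w + ((-p : ℤ) : ℝ) := by
    intro w hw
    have h1 := iter_sub_int Φ hmono.monotone hlift q w p
    rw [hw, add_sub_cancel_right] at h1
    have h2 := hinv₁.iterate q (w - p)
    rw [h1] at h2
    rw [h2]
    push_cast
    ring
  have hA := oneside Φ hcont hmono hlift q p xm xp xp ε hlt hε hxm hxp hxp hattr
    (fun n => {y | y ∈ Ioo xm xp ∧ DD Φ q xp ε n y}) (fun _ => rfl)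
  have hB := oneside Φi hic him hil q (-p) xm xp xm ε hlt hε (hifix _ hxm) (hifix _ hxp)
    (hifix _ hxm) (fun y hy => by simpa using hrep y hy)
    (fun n => {y | y ∈ Ioo xm xp ∧ DD Φi q xm ε n y}) (fun _ => rfl)
  have cA : ∀ n y z, z ∈ Ioo xm xp → y ≤ z → DD Φ q xp ε n y → DD Φ q xp ε n z :=
    fun n y z hz hyz h => closer Φ hmono.monotone q xp ε n y z (mem_uIcc_of_le hyz hz.2.le) h
  have cB : ∀ n y z, z ∈ Ioo xm xp → z ≤ y → DD Φi q xm ε n y → DD Φi q xm ε n z :=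
    fun n y z hz hyz h => closer Φi him.monotone q xm ε n y z (mem_uIcc_of_ge hz.1.le hyz) h
  obtain ⟨x, hx, hiff⟩ := combine xm xp hlt
    (fun n => {y | y ∈ Ioo xm xp ∧ DD Φ q xp ε n y})
    (fun n => {y | y ∈ Ioo xm xp ∧ DD Φi q xm ε n y}) (fun n y hy => hy.1) (fun n y hy => hy.1)
    (fun n y hy z hz hyz => ⟨hz, cA n y z hz hyz hy.2⟩)
    (fun n y hy z hz hyz => ⟨hz, cB n y z hz hyz hy.2⟩) hA hB
  simp only [mem_ofPred_eq, hx, true_and] at hiff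
  have eA : ∀ n y, DD Φ q xp ε n y ↔
      ∀ i : ℕ, i < q → |Φ^[n * q + i] y - n * (p : ℝ) - Φ^[i] xp| < ε := by
    intro n y
    refine forall_congr' fun i => imp_congr_right fun _ => ?_
    rw [fix_iter Φ hmono.monotone hlift q p xp hxp, sub_sub, add_comm (Φ^[i] xp)]
  have eB : ∀ n y, DD Φi q xm ε n y ↔
      ∀ i : ℕ, i < q → |Φi^[n * q + i] y + n * (p : ℝ) - Φi^[i] xm| < ε := by
    intro n y
    refine forall_congr' fun i => imp_congr_right fun _ => ?_
    rw [fix_iter Φi him.monotone hil q (-p) xm (hifix _ hxm)]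
    push_cast
    rw [show Φi^[n * q + i] y - (Φi^[i] xm + n * -(p : ℝ)) =
      Φi^[n * q + i] y + n * (p : ℝ) - Φi^[i] xm by ring]
  refine ⟨x, hx, fun y hy n h => ?_, fun y hy n h => ?_⟩
  · rw [← eB] at h
    rw [← eA]
    exact cA n x y ⟨hx.1.trans_le hy.1, hy.2⟩ hy.1 ((hiff n).2 (cB n y x hx hy.1 h))
  · rw [← eA] at h
    rw [← eB]
    exact cB n x y ⟨hy.1, hy.2.trans_lt hx.2⟩ hy.2 ((hiff n).1 (cA n y x hx hy.2 h))
end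

section
/- Let Φ be a lift of an orientation-preserving circle homeomorphism φ of ℝ/ℤ with rotation number ρ(Φ) = p/q (q ≥ 1). For every ε > 0 there exists N ∈ ℕ such that for every point z ∈ ℝ/ℤ at least one of the following holds: (a) there exists z₀ ∈ ℝ/ℤ with φ^q(z₀) = z₀ such that d(φ^{nq+i}(z), φ^{i}(z₀)) < ε for all n ≥ N and all i = 0, 1, …, q−1; or (b) there exists z₀ ∈ ℝ/ℤ with φ^q(z₀) = z₀ such that d(φ^{−nq−i}(z), φ^{−i}(z₀)) < ε for all n ≥ N and all i = 0, 1, …, q−1. That is, after Nq iterations forward or Nq iterations backward every point is ε-close to a periodic orbit, with N uniform in z. -/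
open Filter

lemma aux_forward (F : ℝ → ℝ) (hc : Continuous F) (hm : StrictMono F)
    (hfix : ∀ y, ∃ b, y ≤ b ∧ F b = b) (δ : ℝ) (hδ : 0 < δ) (y : ℝ) (hy : y < F y) :
    ∃ N : ℕ, ∀ᶠ x in nhds y, ∃ x₀, F x₀ = x₀ ∧ ∀ n, N ≤ n → |F^[n] x - x₀| < δ := by
  obtain ⟨c, hyc, hcf⟩ := hfix y
  have hmono : Monotone (fun n => F^[n] y) :=
    monotone_nat_of_le_succ fun n => by
      rw [Function.iterate_succ_apply]
      exact (hm.iterate n).monotone hy.le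
  have hbd : ∀ n, F^[n] y ≤ c := fun n => by
    have := (hm.iterate n).monotone hyc
    rwa [Function.iterate_fixed hcf n] at this
  have hb : BddAbove (Set.range fun n => F^[n] y) := ⟨c, by rintro _ ⟨n, rfl⟩; exact hbd n⟩
  have ht := tendsto_atTop_ciSup hmono hb
  set b := ⨆ n, F^[n] y with hbdef
  have hbf : F b = b := by
    have h1 : Tendsto (fun n => F^[n+1] y) atTop (nhds b) :=
      (tendsto_add_atTop_iff_nat (f := fun n => F^[n] y) 1).2 ht
    have h2 : Tendsto (fun n => F^[n+1] y) atTop (nhds (F b)) := by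
      simp only [Function.iterate_succ_apply']
      exact (hc.tendsto b).comp ht
    exact tendsto_nhds_unique h2 h1
  have hlt : ∀ n, F^[n] y < F^[n+1] y := fun n => by
    rw [Function.iterate_succ_apply]
    exact hm.iterate n hy
  have hltb : ∀ n, F^[n] y < b := fun n => (hlt n).trans_le (le_ciSup hb (n+1))
  obtain ⟨N, hN⟩ := (ht.eventually (lt_mem_nhds (show b - δ < b by linarith))).exists
  refine ⟨N, ?_⟩
  have e1 := (hc.iterate N).continuousAt.eventually (lt_mem_nhds hN)
  have e2 := (hc.iterate N).continuousAt.eventually (gt_mem_nhds (hltb N))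
  have e4 : ∀ᶠ x in nhds y, x < F x := (continuousAt_id).eventually_lt hc.continuousAt hy
  filter_upwards [e1, e2, e4] with x h1 h2 h4
  refine ⟨b, hbf, fun n hn => ?_⟩
  have hmx : Monotone (fun n => F^[n] x) :=
    monotone_nat_of_le_succ fun n => by
      rw [Function.iterate_succ_apply]
      exact (hm.iterate n).monotone h4.le
  have h5 : F^[N] x ≤ F^[n] x := hmx hn
  have hxb : x < b := by
    by_contra hcon
    have := (hm.iterate N).monotone (not_lt.1 hcon)
    rw [Function.iterate_fixed hbf N] at this
    linarith
  have h6 := hm.iterate n hxb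
  rw [Function.iterate_fixed hbf n] at h6
  rw [abs_lt]; constructor <;> linarith

lemma aux_stay (F : ℝ → ℝ) (hm : StrictMono F) (y x δ : ℝ) (hy : F y = y)
    (h : (y ≤ x ∧ F x ≤ x) ∨ (x ≤ y ∧ x ≤ F x)) (hx : |x - y| < δ) (n : ℕ) :
    |F^[n] x - y| < δ := by
  rw [abs_lt] at hx ⊢
  have hm' := (hm.iterate n).monotone
  rcases h with ⟨h1, h2⟩ | ⟨h1, h2⟩
  · have h3 := hm' h1
    rw [Function.iterate_fixed hy n] at h3
    have h4 : F^[n] x ≤ x := by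
      have := hm.monotone.antitone_iterate_of_map_le h2 (Nat.zero_le n)
      simpa using this
    constructor <;> linarith
  · have h3 := hm' h1
    rw [Function.iterate_fixed hy n] at h3
    have h4 : x ≤ F^[n] x := by
      have := hm.monotone.monotone_iterate_of_le_map h2 (Nat.zero_le n)
      simpa using this
    constructor <;> linarith

lemma aux_key (F G : ℝ → ℝ) (hcF : Continuous F) (hcG : Continuous G)
    (hF : StrictMono F) (hG : StrictMono G) (hFG : ∀ x, F (G x) = x) (hGF : ∀ x, G (F x) = x)
    (hfix : ∀ y, ∃ b, y ≤ b ∧ F b = b) (δ : ℝ) (hδ : 0 < δ) :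
    ∃ N : ℕ, ∀ x ∈ Set.Icc (0:ℝ) 1,
      (∃ x₀, F x₀ = x₀ ∧ ∀ n, N ≤ n → |F^[n] x - x₀| < δ) ∨
      (∃ x₀, F x₀ = x₀ ∧ ∀ n, N ≤ n → |G^[n] x - x₀| < δ) := by
  have hGfix : ∀ x, G x = x ↔ F x = x := fun x =>
    ⟨fun h => by rw [← h, hFG, h], fun h => by rw [← h, hGF, h]⟩
  have hloc : ∀ y : ℝ, ∃ N : ℕ, ∀ᶠ x in nhds y,
      (∃ x₀, F x₀ = x₀ ∧ ∀ n, N ≤ n → |F^[n] x - x₀| < δ) ∨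
      (∃ x₀, F x₀ = x₀ ∧ ∀ n, N ≤ n → |G^[n] x - x₀| < δ) := by
    intro y
    rcases lt_trichotomy y (F y) with h | h | h
    · obtain ⟨N, hN⟩ := aux_forward F hcF hF hfix δ hδ y h
      exact ⟨N, hN.mono fun x hx => Or.inl hx⟩
    · refine ⟨0, ?_⟩
      filter_upwards [Metric.ball_mem_nhds y hδ] with x hx
      rw [Metric.mem_ball, Real.dist_eq] at hx
      have hyG := (hGfix y).2 h.symm
      have hle : F x ≤ x ↔ x ≤ G x := by
        rw [← hG.le_iff_le, hGF]
      have hge : x ≤ F x ↔ G x ≤ x := by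
        rw [← hG.le_iff_le, hGF]
      rcases le_total y x with h1 | h1 <;> rcases le_total x (F x) with h2 | h2
      · exact Or.inr ⟨y, h.symm, fun n _ => aux_stay G hG y x δ hyG (Or.inl ⟨h1, hge.1 h2⟩) hx n⟩
      · exact Or.inl ⟨y, h.symm, fun n _ => aux_stay F hF y x δ h.symm (Or.inl ⟨h1, h2⟩) hx n⟩
      · exact Or.inl ⟨y, h.symm, fun n _ => aux_stay F hF y x δ h.symm (Or.inr ⟨h1, h2⟩) hx n⟩
      · exact Or.inr ⟨y, h.symm, fun n _ => aux_stay G hG y x δ hyG (Or.inr ⟨h1, hle.1 h2⟩) hx n⟩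
    · have h' : y < G y := by
        have := hG h
        rwa [hGF] at this
      obtain ⟨N, hN⟩ := aux_forward G hcG hG
        (fun y => (hfix y).imp fun b hb => ⟨hb.1, (hGfix b).2 hb.2⟩) δ hδ y h'
      exact ⟨N, hN.mono fun x ⟨x₀, h0, hx⟩ => Or.inr ⟨x₀, (hGfix x₀).1 h0, hx⟩⟩
  choose N hN using hloc
  obtain ⟨t, -, ht⟩ := isCompact_Icc.elim_nhds_subcover (s := Set.Icc (0:ℝ) 1) _ (fun y _ => hN y)
  refine ⟨t.sup N, fun x hx => ?_⟩
  obtain ⟨y, hyt, hy⟩ := Set.mem_iUnion₂.1 (ht hx)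
  have hle : N y ≤ t.sup N := Finset.le_sup hyt
  rcases hy with ⟨x₀, h0, h⟩ | ⟨x₀, h0, h⟩
  · exact Or.inl ⟨x₀, h0, fun n hn => h n (hle.trans hn)⟩
  · exact Or.inr ⟨x₀, h0, fun n hn => h n (hle.trans hn)⟩

lemma aux_unif (f : AddCircle (1 : ℝ) → AddCircle (1 : ℝ)) (hf : Continuous f) (q : ℕ)
    (ε : ℝ) (hε : 0 < ε) :
    ∃ δ > 0, ∀ a b, dist a b < δ → ∀ i, i < q → dist (f^[i] a) (f^[i] b) < ε := by
  induction q with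
  | zero => exact ⟨1, one_pos, fun a b _ i hi => absurd hi (Nat.not_lt_zero i)⟩
  | succ q ih =>
    obtain ⟨δ, hδ, h⟩ := ih
    have : Fact ((0:ℝ) < 1) := ⟨one_pos⟩
    obtain ⟨δ', hδ', h'⟩ := Metric.uniformContinuous_iff.1
      (CompactSpace.uniformContinuous_of_continuous (hf.iterate q)) ε hε
    refine ⟨min δ δ', lt_min hδ hδ', fun a b hab i hi => ?_⟩
    rcases Nat.lt_succ_iff_lt_or_eq.1 hi with hi | rfl
    · exact h a b (hab.trans_le (min_le_left _ _)) i hi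
    · exact h' (hab.trans_le (min_le_right _ _))

lemma aux_dist (x y : ℝ) : dist (x : AddCircle (1:ℝ)) (y : AddCircle (1:ℝ)) ≤ |x - y| := by
  rw [dist_eq_norm, ← AddCircle.coe_sub]
  exact QuotientAddGroup.norm_mk_le_norm

lemma aux_cont (f : AddCircle (1 : ℝ) → AddCircle (1 : ℝ)) (g : ℝ → ℝ) (hg : Continuous g)
    (h : ∀ x : ℝ, f (x : AddCircle (1 : ℝ)) = ((g x : ℝ) : AddCircle (1 : ℝ))) :
    Continuous f := by
  refine (QuotientAddGroup.isQuotientMap_mk (N := AddSubgroup.zmultiples (1:ℝ))).continuous_iff.2 ?_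
  have : f ∘ (QuotientAddGroup.mk : ℝ → AddCircle (1:ℝ)) = fun x => ((g x : ℝ) : AddCircle (1:ℝ)) :=
    funext h
  exact this ▸ (AddCircle.continuous_mk' 1).comp hg



/-- Uniform `N`: for a circle homeomorphism `φ` (induced by the lift `Φ`)
with rotation number `p/q`, for each `ε > 0` there is `N` such that every point, after `Nq`
iterations forward or `Nq` iterations backward, stays `ε`-close to a periodic orbit. -/
theorem uniform_N_near_periodic_orbit
    (Φ : ℝ → ℝ) (hcont : Continuous Φ) (hmono : StrictMono Φ)
    (hbij : Function.Bijective Φ) (hlift : ∀ x : ℝ, Φ (x + 1) = Φ x + 1)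
    (φ φi : AddCircle (1 : ℝ) → AddCircle (1 : ℝ))
    (hφ : ∀ x : ℝ, φ (x : AddCircle (1 : ℝ)) = ((Φ x : ℝ) : AddCircle (1 : ℝ)))
    (hφi₁ : Function.LeftInverse φi φ) (hφi₂ : Function.RightInverse φi φ)
    (p : ℤ) (q : ℕ) (hq : 1 ≤ q)
    (hrot : ∀ x : ℝ, Tendsto (fun n : ℕ => Φ^[n] x / n) atTop (nhds ((p : ℝ) / (q : ℝ))))
    (ε : ℝ) (hε : 0 < ε) :
    ∃ N : ℕ, ∀ z : AddCircle (1 : ℝ),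
      (∃ z₀ : AddCircle (1 : ℝ), φ^[q] z₀ = z₀ ∧
        ∀ n : ℕ, N ≤ n → ∀ i : ℕ, i < q → dist (φ^[n * q + i] z) (φ^[i] z₀) < ε) ∨
      (∃ z₀ : AddCircle (1 : ℝ), φ^[q] z₀ = z₀ ∧
        ∀ n : ℕ, N ≤ n → ∀ i : ℕ, i < q → dist (φi^[n * q + i] z) (φi^[i] z₀) < ε) := by

  have hsF : ∀ (n : ℕ) (x : ℝ), φ^[n] (x : AddCircle (1:ℝ)) = ((Φ^[n] x : ℝ) : AddCircle (1:ℝ)) :=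
    fun n x => ((Function.Semiconj.iterate_right
      (f := fun x : ℝ => (x : AddCircle (1:ℝ))) (fun x => (hφ x).symm) n) x).symm
  let e : ℝ ≃o ℝ := hmono.orderIsoOfSurjective Φ hbij.2
  have he : ∀ x, e x = Φ x := fun x => rfl
  let Ψ : ℝ → ℝ := e.symm
  have hΨc : Continuous Ψ := e.symm.continuous
  have hΨm : StrictMono Ψ := e.symm.strictMono
  have hΦΨ : Function.LeftInverse Φ Ψ := fun x => e.apply_symm_apply x
  have hΨΦ : Function.LeftInverse Ψ Φ := fun x => e.symm_apply_apply x
  have hφi : ∀ x : ℝ, φi (x : AddCircle (1 : ℝ)) = ((Ψ x : ℝ) : AddCircle (1 : ℝ)) := fun x => by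
    have := hφi₁ ((Ψ x : ℝ) : AddCircle (1:ℝ))
    rwa [hφ, hΦΨ] at this
  have hsG : ∀ (n : ℕ) (x : ℝ), φi^[n] (x : AddCircle (1:ℝ)) = ((Ψ^[n] x : ℝ) : AddCircle (1:ℝ)) :=
    fun n x => ((Function.Semiconj.iterate_right
      (f := fun x : ℝ => (x : AddCircle (1:ℝ))) (fun x => (hφi x).symm) n) x).symm
  have hpz : ((p : ℝ) : AddCircle (1:ℝ)) = 0 := by
    rw [AddCircle.coe_eq_zero_iff]
    exact ⟨p, by simp⟩
  let F : ℝ → ℝ := fun x => Φ^[q] x - p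
  let G : ℝ → ℝ := fun x => Ψ^[q] (x + p)
  have hFq : ∀ x : ℝ, φ^[q] (x : AddCircle (1:ℝ)) = ((F x : ℝ) : AddCircle (1:ℝ)) := fun x => by
    rw [hsF, AddCircle.coe_sub, hpz, sub_zero]
  have hGq : ∀ x : ℝ, φi^[q] (x : AddCircle (1:ℝ)) = ((G x : ℝ) : AddCircle (1:ℝ)) := fun x => by
    rw [← hsG, AddCircle.coe_add, hpz, add_zero]
  have hFn : ∀ (n : ℕ) (x : ℝ), φ^[n * q] (x : AddCircle (1:ℝ)) = ((F^[n] x : ℝ) : AddCircle (1:ℝ)) :=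
    fun n x => by
      rw [mul_comm, Function.iterate_mul]
      exact ((Function.Semiconj.iterate_right
        (f := fun x : ℝ => (x : AddCircle (1:ℝ))) (fun x => (hFq x).symm) n) x).symm
  have hGn : ∀ (n : ℕ) (x : ℝ), φi^[n * q] (x : AddCircle (1:ℝ)) = ((G^[n] x : ℝ) : AddCircle (1:ℝ)) :=
    fun n x => by
      rw [mul_comm, Function.iterate_mul]
      exact ((Function.Semiconj.iterate_right
        (f := fun x : ℝ => (x : AddCircle (1:ℝ))) (fun x => (hGq x).symm) n) x).symm
  have hfix : ∀ y, ∃ b, y ≤ b ∧ F b = b := by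
    let f : CircleDeg1Lift := ⟨⟨Φ, hmono.monotone⟩, hlift⟩
    have hfc : ⇑f = Φ := rfl
    have hτ : f.translationNumber = p / q := by
      have h1 := f.tendsto_translation_number₀
      refine tendsto_nhds_unique h1 ?_
      have := hrot 0
      simpa [CircleDeg1Lift.coe_pow, hfc] using this
    obtain ⟨x, hx⟩ := (f.translationNumber_eq_rat_iff hcont hq).1 hτ
    intro y
    obtain ⟨k, hk⟩ := exists_nat_ge (y - x)
    refine ⟨x + k, by linarith, ?_⟩
    have h2 := (f ^ q).map_add_nat x k
    rw [hx, CircleDeg1Lift.coe_pow, hfc] at h2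
    change Φ^[q] (x + k) - p = x + k
    rw [h2]; ring
  obtain ⟨δ₁, hδ₁, h₁⟩ := aux_unif φ (aux_cont φ Φ hcont hφ) q ε hε
  obtain ⟨δ₂, hδ₂, h₂⟩ := aux_unif φi (aux_cont φi Ψ hΨc hφi) q ε hε
  obtain ⟨N, hN⟩ := aux_key F G ((hcont.iterate q).sub continuous_const)
    ((hΨc.iterate q).comp (continuous_id.add continuous_const))
    (fun a b h => sub_lt_sub_right (hmono.iterate q h) _)
    (fun a b h => hΨm.iterate q (by simpa using h))
    (fun x => by
      change Φ^[q] (Ψ^[q] (x + p)) - p = x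
      rw [hΦΨ.iterate q]; ring)
    (fun x => by
      change Ψ^[q] (Φ^[q] x - p + p) = x
      rw [sub_add_cancel, hΨΦ.iterate q])
    hfix (min δ₁ δ₂) (lt_min hδ₁ hδ₂)
  refine ⟨N, fun z => ?_⟩
  obtain ⟨x, hx, rfl⟩ : ∃ x ∈ Set.Icc (0:ℝ) 1, (x : AddCircle (1:ℝ)) = z := by
    have : Fact ((0:ℝ) < 1) := ⟨one_pos⟩
    have : z ∈ ((↑) : ℝ → AddCircle (1:ℝ)) '' Set.Icc 0 (0 + 1) := by
      rw [AddCircle.coe_image_Icc_eq]; trivial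
    rw [zero_add] at this
    exact this
  rcases hN x hx with ⟨x₀, h0, h⟩ | ⟨x₀, h0, h⟩
  · refine Or.inl ⟨(x₀ : AddCircle (1:ℝ)), by rw [hFq, h0], fun n hn i hi => ?_⟩
    rw [add_comm, Function.iterate_add_apply, hFn]
    exact h₁ _ _ (((aux_dist _ _).trans_lt (h n hn)).trans_le (min_le_left _ _)) i hi
  · refine Or.inr ⟨(x₀ : AddCircle (1:ℝ)), by rw [hFq, h0], fun n hn i hi => ?_⟩
    rw [add_comm, Function.iterate_add_apply, hGn]
    exact h₂ _ _ (((aux_dist _ _).trans_lt (h n hn)).trans_le (min_le_right _ _)) i hi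
end

section
/- Let Φ be a lift of an orientation-preserving circle homeomorphism with irrational rotation number ρ(Φ), let φ be the induced homeomorphism of ℝ/ℤ, and let Δ ⊆ ℝ/ℤ be a minimal set of φ. Then for every z ∈ Δ and every lift x ∈ ℝ of z, the set of displacements {Φⁿ(x) − Φⁿ⁻¹(x) : n ≥ 1} is dense in the set Ψ(π⁻¹(Δ) ∩ [0,1]), where Ψ(t) = Φ(t) − t. -/
open Filter Set

/-- For a lift `Φ` of a circle homeomorphism with irrational rotation
number and a minimal set `Δ` of the induced homeomorphism `φ`, the displacements along
the orbit of any point of `Δ` are dense in `Ψ(π⁻¹(Δ) ∩ [0,1])`, where `Ψ t = Φ t - t`. -/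
theorem displacement_dense_in_minimal_set_image
    (Φ : ℝ → ℝ) (hcont : Continuous Φ) (hmono : StrictMono Φ)
    (hbij : Function.Bijective Φ) (hlift : ∀ x : ℝ, Φ (x + 1) = Φ x + 1)
    (ρ : ℝ) (hirr : Irrational ρ)
    (hrot : ∀ x : ℝ, Tendsto (fun n : ℕ => Φ^[n] x / n) atTop (nhds ρ))
    (φ : AddCircle (1 : ℝ) → AddCircle (1 : ℝ))
    (hφ : ∀ x : ℝ, φ (x : AddCircle (1 : ℝ)) = ((Φ x : ℝ) : AddCircle (1 : ℝ)))
    (Δ : Set (AddCircle (1 : ℝ))) (hΔne : Δ.Nonempty) (hΔclosed : IsClosed Δ)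
    (hΔinv : φ '' Δ = Δ)
    (hΔmin : ∀ z ∈ Δ, Δ ⊆ closure (Set.range fun n : ℕ => φ^[n] z))
    (z : AddCircle (1 : ℝ)) (hz : z ∈ Δ) (x : ℝ) (hx : (x : AddCircle (1 : ℝ)) = z) :
    {d : ℝ | ∃ n : ℕ, 1 ≤ n ∧ d = Φ^[n] x - Φ^[n - 1] x} ⊆
        (fun t => Φ t - t) ''
          (((fun t : ℝ => (t : AddCircle (1 : ℝ))) ⁻¹' Δ) ∩ Icc (0 : ℝ) 1) ∧
      (fun t => Φ t - t) ''
          (((fun t : ℝ => (t : AddCircle (1 : ℝ))) ⁻¹' Δ) ∩ Icc (0 : ℝ) 1) ⊆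
        closure {d : ℝ | ∃ n : ℕ, 1 ≤ n ∧ d = Φ^[n] x - Φ^[n - 1] x} := by
  have hper : Function.Periodic (fun t => Φ t - t) 1 := by
    intro t
    simp only [hlift]
    ring
  have hgc : Continuous (hper.lift : AddCircle (1 : ℝ) → ℝ) :=
    continuous_coinduced_dom.mpr (hcont.sub continuous_id)
  have hgl : ∀ t : ℝ, hper.lift (t : AddCircle (1 : ℝ)) = Φ t - t := fun t => hper.lift_coe t
  have hit : ∀ n : ℕ, φ^[n] z = ((Φ^[n] x : ℝ) : AddCircle (1 : ℝ)) := by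
    intro n
    induction n with
    | zero => simp [hx]
    | succ k ih => rw [Function.iterate_succ_apply', Function.iterate_succ_apply', ih, hφ]
  have hmem : ∀ n : ℕ, φ^[n] z ∈ Δ := by
    intro n
    induction n with
    | zero => simpa using hz
    | succ k ih =>
      rw [Function.iterate_succ_apply', ← hΔinv]
      exact mem_image_of_mem φ ih
  constructor
  · rintro d ⟨n, hn, rfl⟩
    obtain ⟨m, rfl⟩ : ∃ m, n = m + 1 := ⟨n - 1, by omega⟩
    have hfr : ((Int.fract (Φ^[m] x) : ℝ) : AddCircle (1 : ℝ)) = ((Φ^[m] x : ℝ) : AddCircle (1 : ℝ)) := by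
      rw [QuotientAddGroup.eq, AddSubgroup.mem_zmultiples_iff]
      refine ⟨⌊Φ^[m] x⌋, ?_⟩
      have := Int.floor_add_fract (Φ^[m] x)
      rw [zsmul_eq_mul]
      linarith
    refine ⟨Int.fract (Φ^[m] x), ⟨?_, Int.fract_nonneg _, (Int.fract_lt_one _).le⟩, ?_⟩
    · rw [mem_preimage, hfr, ← hit]
      exact hmem m
    · simp only [Nat.add_sub_cancel, Function.iterate_succ_apply']
      rw [← hgl, ← hgl, hfr]
  · rintro d ⟨t, ⟨ht, -⟩, rfl⟩
    have h1 : hper.lift (t : AddCircle (1 : ℝ)) ∈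
        closure (hper.lift '' (Set.range fun n : ℕ => φ^[n] z)) :=
      image_closure_subset_closure_image hgc (mem_image_of_mem _ (hΔmin z hz ht))
    rw [hgl] at h1
    refine closure_mono ?_ h1
    rintro _ ⟨_, ⟨n, rfl⟩, rfl⟩
    refine ⟨n + 1, by omega, ?_⟩
    simp only [Nat.add_sub_cancel, Function.iterate_succ_apply']
    rw [hit, hgl]
end

section
/- Let Φ be a lift of an orientation-preserving circle homeomorphism with irrational rotation number ρ(Φ), let φ be the induced homeomorphism of ℝ/ℤ, and suppose φ is not minimal, with minimal set Δ ⊆ ℝ/ℤ. Then for every z ∈ (ℝ/ℤ) \ Δ and every w ∈ Δ there exist strictly increasing sequences (n_k) and (n̂_k) of natural numbers such that for every l ∈ ℤ, η_l(φ^{n_k}(z)) → η_l(w) and η_l(φ^{−n̂_k}(z)) → η_l(w) as k → ∞, where for u ∈ ℝ/ℤ with lift y ∈ ℝ one sets η_l(u) = Φ^l(y) − Φ^{l−1}(y) (independent of the choice of lift). -/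
open Filter Set

/-- Two-sided iterate of `Φ` (with inverse `Φi`): `Φ^n` for `n ∈ ℤ`. -/
noncomputable def iterZ (Φ Φi : ℝ → ℝ) (n : ℤ) (x : ℝ) : ℝ :=
  if 0 ≤ n then Φ^[n.toNat] x else Φi^[(-n).toNat] x

/-- The displacement `η_l(x) = Φ^l(x) - Φ^(l-1)(x)`, `l ∈ ℤ`. -/
noncomputable def dispZ (Φ Φi : ℝ → ℝ) (l : ℤ) (x : ℝ) : ℝ :=
  iterZ Φ Φi l x - iterZ Φ Φi (l - 1) x

lemma aux_hit (G : CircleDeg1Lift) (hG : G.translationNumber ≠ 0) (c x : ℝ) :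
    ∃ (k : ℕ) (j : ℤ), G^[k] (x + j) ∈ Set.uIcc c (G c) := by
  have key : ∀ y : ℝ, Tendsto (fun n : ℕ => G^[n] y / n) atTop (nhds G.translationNumber) := by
    intro y
    have h := (G.tendsto_translationNumber y).add
      (tendsto_const_div_atTop_nhds_zero_nat y)
    simp only [add_zero] at h
    refine h.congr fun n => ?_
    rw [← add_div, CircleDeg1Lift.coe_pow]; simp
  have hnat : Tendsto (fun n : ℕ => (n : ℝ)) atTop atTop := tendsto_natCast_atTop_atTop
  rcases lt_trichotomy c (G c) with h | h | h
  · have h0 : 0 < G.translationNumber := by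
      refine lt_of_le_of_ne ?_ hG.symm
      simpa using G.le_translationNumber_of_add_int_le (x := c) (m := 0) (by simpa using h.le)
    obtain ⟨j, hj⟩ := exists_int_lt (c - x)
    have ht : Tendsto (fun n : ℕ => G^[n] (x + j)) atTop atTop := by
      refine ((key (x + j)).pos_mul_atTop h0 hnat).congr' ?_
      filter_upwards [eventually_gt_atTop 0] with n hn
      field_simp
    have hex : ∃ n : ℕ, c < G^[n] (x + j) := (ht.eventually_gt_atTop c).exists
    classical
    have hs := Nat.find_spec hex
    refine ⟨Nat.find hex, j, ?_⟩
    rw [uIcc_of_le h.le]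
    refine ⟨hs.le, ?_⟩
    rcases hk : Nat.find hex with _ | k
    · rw [hk] at hs; simp at hs; linarith
    · rw [Function.iterate_succ_apply']
      exact G.mono (not_lt.1 (Nat.find_min hex (m := k) (by omega)))
  · exfalso
    apply hG
    simpa using G.translationNumber_of_eq_add_int (x := c) (m := 0) (by simpa using h.symm)
  · have h0 : G.translationNumber < 0 := by
      refine lt_of_le_of_ne ?_ hG
      simpa using G.translationNumber_le_of_le_add_int (x := c) (m := 0) (by simpa using h.le)
    obtain ⟨j, hj⟩ := exists_int_gt (c - x)
    have ht : Tendsto (fun n : ℕ => G^[n] (x + j)) atTop atBot := by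
      refine ((key (x + j)).neg_mul_atTop h0 hnat).congr' ?_
      filter_upwards [eventually_gt_atTop 0] with n hn
      field_simp
    have hex : ∃ n : ℕ, G^[n] (x + j) < c := (ht.eventually_lt_atBot c).exists
    classical
    have hs := Nat.find_spec hex
    refine ⟨Nat.find hex, j, ?_⟩
    rw [uIcc_of_ge h.le]
    refine ⟨?_, hs.le⟩
    rcases hk : Nat.find hex with _ | k
    · rw [hk] at hs; simp at hs; linarith
    · rw [Function.iterate_succ_apply']
      exact G.mono (not_lt.1 (Nat.find_min hex (m := k) (by omega)))

lemma aux_iter_add (F : CircleDeg1Lift) (n : ℕ) (y : ℝ) (j : ℤ) :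
    F^[n] (y + j) = F^[n] y + j := by
  rw [← CircleDeg1Lift.coe_pow]; exact (F ^ n).map_add_int y j

lemma aux_hit' (F : CircleDeg1Lift) (hF : Irrational F.translationNumber) (s : ℕ) (hs : 0 < s)
    (m : ℤ) (c x : ℝ) :
    ∃ (n : ℕ) (j : ℤ), F^[n] x + j ∈ Set.uIcc c (F^[s] c + m) := by
  let T : CircleDeg1Lift := (CircleDeg1Lift.translate (Multiplicative.ofAdd (m : ℝ)))
  have hT : ∀ y, T y = m + y := fun y => CircleDeg1Lift.translate_apply _ _
  have hTτ : T.translationNumber = m := CircleDeg1Lift.translationNumber_translate _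
  have hGa : ∀ y, (T * F ^ s) y = F^[s] y + m := by
    intro y
    rw [CircleDeg1Lift.mul_apply, hT, CircleDeg1Lift.coe_pow, add_comm]
  have hcomm : Commute T (F ^ s) := by
    apply CircleDeg1Lift.ext
    intro y
    rw [CircleDeg1Lift.mul_apply, CircleDeg1Lift.mul_apply, hT, hT, CircleDeg1Lift.map_int_add]
  have hτ : (T * F ^ s).translationNumber ≠ 0 := by
    rw [CircleDeg1Lift.translationNumber_mul_of_commute hcomm, hTτ,
      CircleDeg1Lift.translationNumber_pow]
    have := (hF.natCast_mul hs.ne').intCast_add m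
    exact this.ne_zero
  obtain ⟨k, j, hk⟩ := aux_hit _ hτ c x
  have hit : ∀ (k : ℕ) (y : ℝ), ∃ i : ℤ, (T * F ^ s)^[k] y = F^[s * k] y + i := by
    intro k y
    induction k with
    | zero => exact ⟨0, by simp⟩
    | succ k ih =>
      obtain ⟨i, hi⟩ := ih
      refine ⟨i + m, ?_⟩
      rw [Function.iterate_succ_apply', hi, hGa, aux_iter_add, ← Function.iterate_add_apply,
        Nat.mul_succ, add_comm s]
      push_cast; ring
  obtain ⟨i, hi⟩ := hit k (x + j)
  refine ⟨s * k, j + i, ?_⟩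
  rw [hGa, hi, aux_iter_add] at hk
  push_cast
  rwa [← add_assoc]

lemma aux_seq (F : CircleDeg1Lift) (v x : ℝ)
    (h : ∀ ε > 0, ∀ y : ℝ, ∃ (n : ℕ) (j : ℤ), |F^[n] y + j - v| < ε) :
    ∃ nk : ℕ → ℕ, StrictMono nk ∧ ∃ j : ℕ → ℤ,
      Tendsto (fun k => F^[nk k] x + j k) atTop (nhds v) := by
  obtain ⟨nk, hnk, hP⟩ := extraction_forall_of_frequently
    (P := fun k n => ∃ j : ℤ, |F^[n] x + j - v| < 1 / ((k : ℝ) + 1)) (by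
      intro k
      rw [frequently_atTop]
      intro N
      obtain ⟨n, j, hn⟩ := h (1 / ((k : ℝ) + 1)) (by positivity) (F^[N] x)
      refine ⟨n + N, by omega, j, ?_⟩
      rwa [Function.iterate_add_apply])
  choose j hj using hP
  refine ⟨nk, hnk, j, ?_⟩
  rw [tendsto_iff_dist_tendsto_zero]
  refine squeeze_zero (fun _ => dist_nonneg) (fun k => ?_)
    tendsto_one_div_add_atTop_nhds_zero_nat
  rw [Real.dist_eq]; exact (hj k).le

/-- If `φ` (induced by `Φ`) is not minimal, with minimal set `Δ`, then
for `z ∉ Δ` and `w ∈ Δ` there are strictly increasing sequences `n_k`, `n̂_k` such that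
for every `l ∈ ℤ`, `η_l(φ^{n_k}(z)) → η_l(w)` and `η_l(φ^{-n̂_k}(z)) → η_l(w)`;
here displacements of circle points are computed via lifts. -/
theorem displacement_omega_alpha_limit
    (Φ Φi : ℝ → ℝ) (hcont : Continuous Φ) (hmono : StrictMono Φ)
    (hbij : Function.Bijective Φ) (hlift : ∀ x : ℝ, Φ (x + 1) = Φ x + 1)
    (hinv₁ : Function.LeftInverse Φi Φ) (hinv₂ : Function.RightInverse Φi Φ)
    (ρ : ℝ) (hirr : Irrational ρ)
    (hrot : ∀ x : ℝ, Tendsto (fun n : ℕ => Φ^[n] x / n) atTop (nhds ρ))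
    (φ : AddCircle (1 : ℝ) → AddCircle (1 : ℝ))
    (hφ : ∀ x : ℝ, φ (x : AddCircle (1 : ℝ)) = ((Φ x : ℝ) : AddCircle (1 : ℝ)))
    (hnotmin : ¬ ∀ z : AddCircle (1 : ℝ), Dense (Set.range fun n : ℕ => φ^[n] z))
    (Δ : Set (AddCircle (1 : ℝ))) (hΔne : Δ.Nonempty) (hΔclosed : IsClosed Δ)
    (hΔinv : φ '' Δ = Δ)
    (hΔmin : ∀ u ∈ Δ, Δ ⊆ closure (Set.range fun n : ℕ => φ^[n] u))
    (z : AddCircle (1 : ℝ)) (hz : z ∉ Δ) (w : AddCircle (1 : ℝ)) (hw : w ∈ Δ)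
    (x : ℝ) (hx : (x : AddCircle (1 : ℝ)) = z)
    (v : ℝ) (hv : (v : AddCircle (1 : ℝ)) = w) :
    ∃ nk : ℕ → ℕ, StrictMono nk ∧ ∃ mk : ℕ → ℕ, StrictMono mk ∧
      ∀ l : ℤ,
        Tendsto (fun k : ℕ => dispZ Φ Φi l (Φ^[nk k] x)) atTop (nhds (dispZ Φ Φi l v)) ∧
        Tendsto (fun k : ℕ => dispZ Φ Φi l (Φi^[mk k] x)) atTop (nhds (dispZ Φ Φi l v)) := by
  have hFimono : StrictMono Φi := by
    intro a b hab
    rw [← hmono.lt_iff_lt, hinv₂, hinv₂]; exact hab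
  have hFi1 : ∀ y, Φi (y + 1) = Φi y + 1 := by
    intro y
    apply hmono.injective
    rw [hinv₂, hlift, hinv₂]
  let f : CircleDeg1Lift := ⟨⟨Φ, hmono.monotone⟩, hlift⟩
  let fi : CircleDeg1Lift := ⟨⟨Φi, hFimono.monotone⟩, hFi1⟩
  have hf : (f : ℝ → ℝ) = Φ := rfl
  have hfi : (fi : ℝ → ℝ) = Φi := rfl
  have hconti : Continuous Φi := by
    rw [← hfi, fi.continuous_iff_surjective]
    exact hinv₁.surjective
  have hτ : f.translationNumber = ρ := by
    refine f.translationNumber_eq_of_tendsto₀ ?_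
    exact hrot 0
  let u : CircleDeg1Liftˣ := ⟨f, fi, CircleDeg1Lift.ext fun y => hinv₂ y,
    CircleDeg1Lift.ext fun y => hinv₁ y⟩
  have hτi : fi.translationNumber = -ρ := by
    have := CircleDeg1Lift.translationNumber_units_inv u
    rw [← hτ]; exact this
  have hφn : ∀ (n : ℕ) (y : ℝ), φ^[n] (y : AddCircle (1 : ℝ)) = ((Φ^[n] y : ℝ) : AddCircle (1 : ℝ)) := by
    intro n
    induction n with
    | zero => intro y; rfl
    | succ n ih => intro y; rw [Function.iterate_succ_apply, hφ, ih, Function.iterate_succ_apply]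
  have hrec : ∀ ε > 0, ∃ s : ℕ, 0 < s ∧ ∃ m : ℤ, |Φ^[s] v + m - v| < ε := by
    intro ε hε
    have hφw : φ w ∈ Δ := by rw [← hΔinv]; exact mem_image_of_mem _ hw
    obtain ⟨_, ⟨n, rfl⟩, hn⟩ := Metric.mem_closure_iff.1 (hΔmin _ hφw hw) ε hε
    refine ⟨n + 1, by omega, -round (Φ^[n + 1] v - v), ?_⟩
    rw [dist_comm, ← hv, dist_eq_norm] at hn
    simp only [← Function.iterate_succ_apply] at hn
    rw [hφn, ← AddCircle.coe_sub, AddCircle.norm_eq] at hn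
    simp only [inv_one, one_mul, mul_one] at hn
    push_cast
    convert hn using 2
    ring
  have hclose : ∀ {a p q ε : ℝ}, a ∈ Set.uIcc p q → p = v ∨ q = v → |p - q| < ε →
      |a - v| < ε := by
    intro a p q ε ha h1 h2
    rcases h1 with rfl | rfl
    · exact (Set.abs_sub_left_of_mem_uIcc ha).trans_lt (by rwa [abs_sub_comm])
    · rw [abs_sub_comm]
      exact (Set.abs_sub_right_of_mem_uIcc ha).trans_lt (by rwa [abs_sub_comm])
  have hA : ∀ ε > 0, ∀ y : ℝ, ∃ (n : ℕ) (j : ℤ), |f^[n] y + j - v| < ε := by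
    intro ε hε y
    obtain ⟨s, hs, m, hm⟩ := hrec ε hε
    obtain ⟨n, j, h⟩ := aux_hit' f (by rwa [hτ]) s hs m v y
    exact ⟨n, j, hclose h (Or.inl rfl) (by rw [abs_sub_comm]; exact hm)⟩
  have hB : ∀ ε > 0, ∀ y : ℝ, ∃ (n : ℕ) (j : ℤ), |fi^[n] y + j - v| < ε := by
    intro ε hε y
    obtain ⟨s, hs, m, hm⟩ := hrec ε hε
    obtain ⟨n, j, h⟩ := aux_hit' fi (by rw [hτi]; exact hirr.neg) s hs (-m) (Φ^[s] v + m) y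
    have e : fi^[s] (Φ^[s] v + m) + ((-m : ℤ) : ℝ) = v := by
      rw [aux_iter_add, hfi, hinv₁.iterate s]; push_cast; ring
    exact ⟨n, j, hclose h (Or.inr e) (by rw [e]; exact hm)⟩
  have hZadd : ∀ (l : ℤ) (y : ℝ) (j : ℤ), iterZ Φ Φi l (y + j) = iterZ Φ Φi l y + j := by
    intro l y j
    unfold iterZ
    split_ifs
    · exact aux_iter_add f _ y j
    · exact aux_iter_add fi _ y j
  have hZc : ∀ l : ℤ, Continuous (iterZ Φ Φi l) := by
    intro l
    unfold iterZ
    split_ifs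
    · exact hcont.iterate _
    · exact hconti.iterate _
  have hDadd : ∀ (l : ℤ) (y : ℝ) (j : ℤ), dispZ Φ Φi l (y + j) = dispZ Φ Φi l y := by
    intro l y j
    unfold dispZ
    rw [hZadd, hZadd]; ring
  have hDc : ∀ l : ℤ, Continuous (dispZ Φ Φi l) := fun l => (hZc l).sub (hZc (l - 1))
  obtain ⟨nk, hnk, j, hj⟩ := aux_seq f v x hA
  obtain ⟨mk, hmk, i, hi⟩ := aux_seq fi v x hB
  refine ⟨nk, hnk, mk, hmk, fun l => ⟨?_, ?_⟩⟩
  · refine (((hDc l).tendsto v).comp hj).congr fun k => ?_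
    exact hDadd l _ _
  · refine (((hDc l).tendsto v).comp hi).congr fun k => ?_
    exact hDadd l _ _
end

section
/- Continuity of the (semi-)conjugacy in the homeomorphism: Let Φ₁ be a lift of an orientation-preserving circle homeomorphism with irrational rotation number ρ₁ = ρ(Φ₁), let Γ₁ be a lift of a semi-conjugacy of Φ₁ with the translation by ρ₁, and let x₀ ∈ ℝ be a point with Γ₁(x₀) = x₀ whose projection π(x₀) belongs to a minimal set of the induced homeomorphism φ₁. Then for every ε > 0 there exists δ > 0 such that: for every lift Φ₂ of an orientation-preserving circle homeomorphism with irrational rotation number ρ₂ = ρ(Φ₂) satisfying sup_{x∈ℝ} |Φ₁(x) − Φ₂(x)| < δ, and every lift Γ₂ of a semi-conjugacy of Φ₂ with the translation by ρ₂ normalized so that Γ₂(x₀) = x₀, one has sup_{x∈ℝ} |Γ₁(x) − Γ₂(x)| < ε. -/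
open Filter Set

lemma aux_dense (ρ : ℝ) (hρ : Irrational ρ) (c : ℝ) (hc : 0 < c) :
    ∃ N : ℕ, ∀ a : ℝ, ∃ n : ℕ, n ≤ N ∧ ∃ m : ℤ, a < n * ρ + m ∧ n * ρ + m < a + c := by
  obtain ⟨K, hK⟩ := exists_nat_gt (1 / c)
  have hKpos : (0 : ℝ) < K := lt_trans (by positivity) hK
  have hKn : 0 < K := by exact_mod_cast hKpos
  obtain ⟨j, k, hk0, hkK, hjk⟩ := Real.exists_int_int_abs_mul_sub_le ρ hKn
  lift k to ℕ using hk0.le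
  set α : ℝ := ρ * k - j with hα
  have hα0 : α ≠ 0 := by
    intro h
    have hk' : (k : ℝ) ≠ 0 := by
      have : 0 < k := by exact_mod_cast hk0
      positivity
    apply hρ
    refine ⟨(j : ℚ) / k, ?_⟩
    push_cast
    rw [div_eq_iff hk']
    linarith
  have hαc : |α| < c := by
    have h1 : |α| ≤ 1 / (K + 1) := by simpa [hα, mul_comm] using hjk
    have h2 : 1 / ((K : ℝ) + 1) < c := by
      rw [div_lt_iff₀ (by positivity)]
      rw [div_lt_iff₀ hc] at hK
      nlinarith
    linarith
  have hpos : 0 < |α| := abs_pos.mpr hα0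
  have key : ∀ b : ℝ, ∃ t : ℕ, t ≤ ⌊1 / |α|⌋₊ + 1 ∧ ∃ m : ℤ,
      b < t * |α| + m ∧ t * |α| + m ≤ b + |α| := by
    intro b
    refine ⟨⌊Int.fract b / |α|⌋₊ + 1, ?_, ⌊b⌋, ?_, ?_⟩
    · gcongr
      exact (Int.fract_lt_one b).le
    · have := Nat.lt_floor_add_one (Int.fract b / |α|)
      rw [div_lt_iff₀ hpos] at this
      push_cast
      have h3 := Int.fract_add_floor b
      linarith
    · have := Nat.floor_le (div_nonneg (Int.fract_nonneg b) hpos.le)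
      rw [le_div_iff₀ hpos] at this
      push_cast
      have h3 := Int.fract_add_floor b
      linarith
  refine ⟨(⌊1 / |α|⌋₊ + 1) * k, fun a => ?_⟩
  rcases lt_or_gt_of_ne hα0 with h | h
  · obtain ⟨t, ht, m, h1, h2⟩ := key (-a - c)
    refine ⟨t * k, by gcongr, -(t * j) - m, ?_, ?_⟩
    all_goals
      rw [abs_of_neg h] at h1 h2 hαc
      rw [hα] at h1 h2 hαc
      push_cast
      nlinarith
  · obtain ⟨t, ht, m, h1, h2⟩ := key a
    refine ⟨t * k, by gcongr, -(t * j) + m, ?_, ?_⟩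
    all_goals
      rw [abs_of_pos h] at h1 h2 hαc
      rw [hα] at h1 h2 hαc
      push_cast
      nlinarith

lemma aux_iter_one (Φ : ℝ → ℝ) (hΦ : Continuous Φ) (x₀ : ℝ) (n : ℕ) :
    ∀ η : ℝ, 0 < η → ∃ δ : ℝ, 0 < δ ∧ ∀ Ψ : ℝ → ℝ, (∀ x, |Φ x - Ψ x| < δ) →
      |Φ^[n] x₀ - Ψ^[n] x₀| < η := by
  induction n with
  | zero => intro η hη; exact ⟨1, one_pos, fun Ψ _ => by simpa using hη⟩
  | succ n ih =>
    intro η hη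
    obtain ⟨η', hη', hc⟩ := Metric.continuousAt_iff.mp (hΦ.continuousAt (x := Φ^[n] x₀)) (η / 2)
      (by positivity)
    obtain ⟨δ, hδ, h⟩ := ih η' hη'
    refine ⟨min δ (η / 2), by positivity, fun Ψ hΨ => ?_⟩
    have h1 := h Ψ (fun x => (hΨ x).trans_le (min_le_left _ _))
    have h2 := (hΨ (Ψ^[n] x₀)).trans_le (min_le_right _ _)
    have h3 := @hc (Ψ^[n] x₀) (by rw [dist_comm, Real.dist_eq]; exact h1)
    rw [dist_comm, Real.dist_eq] at h3
    rw [Function.iterate_succ_apply', Function.iterate_succ_apply']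
    rw [abs_lt] at *
    constructor <;> linarith [h2.1, h2.2, h3.1, h3.2]

lemma aux_iter (Φ : ℝ → ℝ) (hΦ : Continuous Φ) (x₀ : ℝ) (M : ℕ) (η : ℝ) (hη : 0 < η) :
    ∃ δ : ℝ, 0 < δ ∧ ∀ Ψ : ℝ → ℝ, (∀ x, |Φ x - Ψ x| < δ) →
      ∀ n ≤ M, |Φ^[n] x₀ - Ψ^[n] x₀| < η := by
  induction M with
  | zero =>
    obtain ⟨δ, hδ, h⟩ := aux_iter_one Φ hΦ x₀ 0 η hη
    refine ⟨δ, hδ, fun Ψ hΨ n hn => ?_⟩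
    obtain rfl : n = 0 := by omega
    exact h Ψ hΨ
  | succ M ih =>
    obtain ⟨δ, hδ, h⟩ := aux_iter_one Φ hΦ x₀ (M + 1) η hη
    obtain ⟨δ', hδ', h'⟩ := ih
    refine ⟨min δ δ', by positivity, fun Ψ hΨ n hn => ?_⟩
    rcases Nat.le_succ_iff.mp hn with hn | rfl
    · exact h' Ψ (fun x => (hΨ x).trans_le (min_le_right _ _)) n hn
    · exact h Ψ (fun x => (hΨ x).trans_le (min_le_left _ _))

lemma aux_shift (Γ : ℝ → ℝ) (hm : Monotone Γ) (hl : ∀ x : ℝ, Γ (x + 1) = Γ x + 1) (x : ℝ)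
    (m : ℤ) : Γ (x + m) = Γ x + m :=
  CircleDeg1Lift.map_add_int ⟨⟨Γ, hm⟩, hl⟩ x m

lemma aux_disp (Γ : ℝ → ℝ) (hm : Monotone Γ) (hl : ∀ x : ℝ, Γ (x + 1) = Γ x + 1) (x₀ : ℝ)
    (h0 : Γ x₀ = x₀) (x : ℝ) : |Γ x - x| ≤ 1 := by
  have h1 := Int.floor_le (x - x₀)
  have h2 := Int.lt_floor_add_one (x - x₀)
  have h3 : Γ (x₀ + ⌊x - x₀⌋) ≤ Γ x := hm (by linarith)
  have h4 : Γ x ≤ Γ (x₀ + ⌊x - x₀⌋ + 1) := hm (by linarith)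
  rw [hl] at h4
  rw [aux_shift Γ hm hl, h0] at h3 h4
  rw [abs_le]
  constructor <;> linarith

lemma aux_conj (Γ Φ : ℝ → ℝ) (ρ : ℝ) (h : ∀ x, Γ (Φ x) = Γ x + ρ) (x : ℝ) (n : ℕ) :
    Γ (Φ^[n] x) = Γ x + n * ρ := by
  induction n with
  | zero => simp
  | succ n ih => rw [Function.iterate_succ_apply', h, ih]; push_cast; ring

lemma aux_uc (Γ : ℝ → ℝ) (hc : Continuous Γ) (hm : Monotone Γ)
    (hl : ∀ x : ℝ, Γ (x + 1) = Γ x + 1) (e : ℝ) (he : 0 < e) :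
    ∃ η : ℝ, 0 < η ∧ ∀ x y : ℝ, e ≤ Γ y - Γ x → η ≤ y - x := by
  have hu : UniformContinuousOn Γ (Icc 0 2) :=
    isCompact_Icc.uniformContinuousOn_of_continuous hc.continuousOn
  obtain ⟨η, hη, h⟩ := Metric.uniformContinuousOn_iff.mp hu e he
  refine ⟨min η 1, by positivity, fun x y hxy => ?_⟩
  by_contra! hlt
  have hxy' : x ≤ y := by
    by_contra! h'
    linarith [hm h'.le]
  have hl1 := hlt.trans_le (min_le_left _ _)
  have hl2 := hlt.trans_le (min_le_right _ _)
  have h1 := Int.floor_le x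
  have h2 := Int.lt_floor_add_one x
  have sx := aux_shift Γ hm hl x (-⌊x⌋)
  have sy := aux_shift Γ hm hl y (-⌊x⌋)
  push_cast at sx sy
  have := h (y + -⌊x⌋) ⟨by linarith, by linarith⟩ (x + -⌊x⌋) ⟨by linarith, by linarith⟩
    (by rw [Real.dist_eq, abs_of_nonneg (by linarith)]; linarith)
  rw [Real.dist_eq, sx, sy] at this
  linarith [le_abs_self (Γ y + -⌊x⌋ - (Γ x + -⌊x⌋))]


/-- Continuity of the (semi-)conjugacy in the homeomorphism: if `Γ₁`
semi-conjugates `Φ₁` (irrational rotation number `ρ₁`) to the translation by `ρ₁`, is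
normalized at a point `x₀` of (a lift of) a minimal set, then every lift `Φ₂` close to
`Φ₁`, with irrational rotation number `ρ₂` and normalized semi-conjugacy `Γ₂`, has `Γ₂`
uniformly close to `Γ₁`. -/
theorem semiconjugacy_continuous_in_homeomorphism
    (Φ₁ : ℝ → ℝ) (hcont₁ : Continuous Φ₁) (hmono₁ : StrictMono Φ₁)
    (hbij₁ : Function.Bijective Φ₁) (hlift₁ : ∀ x : ℝ, Φ₁ (x + 1) = Φ₁ x + 1)
    (ρ₁ : ℝ) (hirr₁ : Irrational ρ₁)
    (hrot₁ : ∀ x : ℝ, Tendsto (fun n : ℕ => Φ₁^[n] x / n) atTop (nhds ρ₁))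
    (Γ₁ : ℝ → ℝ) (hΓ₁cont : Continuous Γ₁) (hΓ₁mono : Monotone Γ₁)
    (hΓ₁surj : Function.Surjective Γ₁) (hΓ₁lift : ∀ x : ℝ, Γ₁ (x + 1) = Γ₁ x + 1)
    (hΓ₁conj : ∀ x : ℝ, Γ₁ (Φ₁ x) = Γ₁ x + ρ₁)
    (φ₁ : AddCircle (1 : ℝ) → AddCircle (1 : ℝ))
    (hφ₁ : ∀ x : ℝ, φ₁ (x : AddCircle (1 : ℝ)) = ((Φ₁ x : ℝ) : AddCircle (1 : ℝ)))
    (Δ : Set (AddCircle (1 : ℝ))) (hΔne : Δ.Nonempty) (hΔclosed : IsClosed Δ)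
    (hΔinv : φ₁ '' Δ = Δ)
    (hΔmin : ∀ u ∈ Δ, Δ ⊆ closure (Set.range fun n : ℕ => φ₁^[n] u))
    (x₀ : ℝ) (hx₀fix : Γ₁ x₀ = x₀) (hx₀Δ : (x₀ : AddCircle (1 : ℝ)) ∈ Δ)
    (ε : ℝ) (hε : 0 < ε) :
    ∃ δ : ℝ, 0 < δ ∧
      ∀ (Φ₂ : ℝ → ℝ), Continuous Φ₂ → StrictMono Φ₂ → Function.Bijective Φ₂ →
        (∀ x : ℝ, Φ₂ (x + 1) = Φ₂ x + 1) →
      ∀ ρ₂ : ℝ, Irrational ρ₂ →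
        (∀ x : ℝ, Tendsto (fun n : ℕ => Φ₂^[n] x / n) atTop (nhds ρ₂)) →
      ∀ (Γ₂ : ℝ → ℝ), Continuous Γ₂ → Monotone Γ₂ → Function.Surjective Γ₂ →
        (∀ x : ℝ, Γ₂ (x + 1) = Γ₂ x + 1) → (∀ x : ℝ, Γ₂ (Φ₂ x) = Γ₂ x + ρ₂) →
        Γ₂ x₀ = x₀ →
      (∀ x : ℝ, |Φ₁ x - Φ₂ x| < δ) →
      ∀ x : ℝ, |Γ₁ x - Γ₂ x| < ε := by
  obtain ⟨N, hN⟩ := aux_dense ρ₁ hirr₁ (ε / 4) (by positivity)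
  obtain ⟨η, hη, hη'⟩ := aux_uc Γ₁ hΓ₁cont hΓ₁mono hΓ₁lift (ε / 4) (by positivity)
  obtain ⟨M, hM⟩ := exists_nat_gt (N + N * 12 / ε : ℝ)
  have hNM : N ≤ M := by
    have h0 : (0 : ℝ) ≤ N * 12 / ε := by positivity
    have : (N : ℝ) ≤ M := by linarith
    exact_mod_cast this
  obtain ⟨δ, hδ, hclose⟩ := aux_iter Φ₁ hcont₁ x₀ M (min η 1) (by positivity)
  refine ⟨δ, hδ, ?_⟩
  intro Φ₂ _ _ _ _ ρ₂ _ _ Γ₂ _ hm₂ _ hl₂ hconj₂ hx₂ hd x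
  have hcl := hclose Φ₂ hd
  have hρ : M * |ρ₁ - ρ₂| ≤ 3 := by
    have h1 := aux_disp Γ₁ hΓ₁mono hΓ₁lift x₀ hx₀fix (Φ₁^[M] x₀)
    have h2 := aux_disp Γ₂ hm₂ hl₂ x₀ hx₂ (Φ₂^[M] x₀)
    have h3 := (hcl M le_rfl).trans_le (min_le_right _ _)
    rw [aux_conj Γ₁ Φ₁ ρ₁ hΓ₁conj, hx₀fix] at h1
    rw [aux_conj Γ₂ Φ₂ ρ₂ hconj₂, hx₂] at h2
    have h4 : (M : ℝ) * |ρ₁ - ρ₂| = |M * (ρ₁ - ρ₂)| := by rw [abs_mul, Nat.abs_cast]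
    rw [h4]
    rw [abs_le] at *
    rw [abs_lt] at h3
    constructor <;> linarith [h1.1, h1.2, h2.1, h2.2, h3.1, h3.2]
  have hρN : ∀ n ≤ N, |n * ρ₁ - n * ρ₂| ≤ ε / 4 := by
    intro n hn
    have h4 : |n * ρ₁ - n * ρ₂| = n * |ρ₁ - ρ₂| := by rw [← mul_sub, abs_mul, Nat.abs_cast]
    rw [h4]
    have h5 : (n : ℝ) ≤ N := by exact_mod_cast hn
    have h6 : (N : ℝ) * 12 ≤ M * ε := by
      have : (N : ℝ) * 12 / ε ≤ M := by
        have : (0 : ℝ) ≤ N := by positivity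
        linarith
      rwa [div_le_iff₀ hε] at this
    have h7 := abs_nonneg (ρ₁ - ρ₂)
    have h8 : (n : ℝ) * |ρ₁ - ρ₂| ≤ N * |ρ₁ - ρ₂| := by gcongr
    nlinarith
  have hg₁ : ∀ (n : ℕ) (m : ℤ), Γ₁ (Φ₁^[n] x₀ + m) = x₀ + n * ρ₁ + m := fun n m => by
    rw [aux_shift Γ₁ hΓ₁mono hΓ₁lift, aux_conj Γ₁ Φ₁ ρ₁ hΓ₁conj, hx₀fix]
  have hg₂ : ∀ (n : ℕ) (m : ℤ), Γ₂ (Φ₂^[n] x₀ + m) = x₀ + n * ρ₂ + m := fun n m => by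
    rw [aux_shift Γ₂ hm₂ hl₂, aux_conj Γ₂ Φ₂ ρ₂ hconj₂, hx₂]
  rw [abs_lt]
  constructor
  · obtain ⟨n, hn, m, h1, h2⟩ := hN (Γ₁ x - x₀ + ε / 4)
    have h3 := hη' x (Φ₁^[n] x₀ + m) (by rw [hg₁]; linarith)
    have h4 := abs_lt.mp ((hcl n (hn.trans hNM)).trans_le (min_le_left _ _))
    have h5 : Γ₂ x ≤ Γ₂ (Φ₂^[n] x₀ + m) := hm₂ (by linarith [h4.1, h4.2])
    rw [hg₂] at h5
    have h6 := abs_le.mp (hρN n hn)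
    linarith [h6.1, h6.2]
  · obtain ⟨n, hn, m, h1, h2⟩ := hN (Γ₁ x - x₀ - ε / 2)
    have h3 := hη' (Φ₁^[n] x₀ + m) x (by rw [hg₁]; linarith)
    have h4 := abs_lt.mp ((hcl n (hn.trans hNM)).trans_le (min_le_left _ _))
    have h5 : Γ₂ (Φ₂^[n] x₀ + m) ≤ Γ₂ x := hm₂ (by linarith [h4.1, h4.2])
    rw [hg₂] at h5
    have h6 := abs_le.mp (hρN n hn)
    linarith [h6.1, h6.2]
end

section
/- Let Φ be a lift of an orientation-preserving circle homeomorphism with irrational rotation number ρ = ρ(Φ) whose induced homeomorphism φ of ℝ/ℤ is minimal, and let Γ be a lift of a conjugacy of Φ with the translation by ρ. Let μ be the φ-invariant Borel probability measure on ℝ/ℤ given as the pushforward under π ∘ Γ⁻¹ of Lebesgue measure on [0,1), and let μ_Ψ = ψ̄_*μ be the displacement distribution. Then μ_Ψ equals the pushforward of Lebesgue measure on [0,1) under the map Ω(t) = Γ⁻¹(t+ρ) − Γ⁻¹(t), and the support of μ_Ψ equals Ψ([0,1]) = {Φ(t) − t : t ∈ [0,1]}. -/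
open Filter Set MeasureTheory

/-- The (topological) support of a Borel measure on `ℝ`: points all of whose
neighbourhoods have positive measure. -/
def msupport (μ : Measure ℝ) : Set ℝ := {y : ℝ | ∀ U ∈ nhds y, μ U ≠ 0}

/-- For a minimal circle homeomorphism (lift `Φ`, irrational rotation
number `ρ`, conjugacy lift `Γ` with inverse `Γi`), the displacement distribution
`μ_Ψ = ψ̄_*μ` of the invariant measure `μ = (π ∘ Γ⁻¹)_*(Leb|_{[0,1)})` equals the
pushforward of Lebesgue measure on `[0,1)` under `Ω t = Γ⁻¹(t+ρ) - Γ⁻¹ t`, and its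
support is `Ψ([0,1]) = {Φ t - t : t ∈ [0,1]}`. -/
theorem displacement_distribution_formula
    (Φ Γ Γi : ℝ → ℝ) (hcont : Continuous Φ) (hmono : StrictMono Φ)
    (hbij : Function.Bijective Φ) (hlift : ∀ x : ℝ, Φ (x + 1) = Φ x + 1)
    (ρ : ℝ) (hirr : Irrational ρ)
    (hrot : ∀ x : ℝ, Tendsto (fun n : ℕ => Φ^[n] x / n) atTop (nhds ρ))
    (φ : AddCircle (1 : ℝ) → AddCircle (1 : ℝ))
    (hφ : ∀ x : ℝ, φ (x : AddCircle (1 : ℝ)) = ((Φ x : ℝ) : AddCircle (1 : ℝ)))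
    (hminimal : ∀ z : AddCircle (1 : ℝ), Dense (Set.range fun n : ℕ => φ^[n] z))
    (hΓcont : Continuous Γ) (hΓmono : StrictMono Γ) (hΓbij : Function.Bijective Γ)
    (hΓlift : ∀ x : ℝ, Γ (x + 1) = Γ x + 1)
    (hconj : ∀ x : ℝ, Γ (Φ x) = Γ x + ρ)
    (hΓi₁ : Function.LeftInverse Γi Γ) (hΓi₂ : Function.RightInverse Γi Γ)
    (ψb : AddCircle (1 : ℝ) → ℝ) (hψcont : Continuous ψb)
    (hψ : ∀ x : ℝ, ψb (x : AddCircle (1 : ℝ)) = Φ x - x) :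
    Measure.map ψb
        (Measure.map (fun t : ℝ => ((Γi t : ℝ) : AddCircle (1 : ℝ)))
          (volume.restrict (Ico (0 : ℝ) 1))) =
      Measure.map (fun t : ℝ => Γi (t + ρ) - Γi t) (volume.restrict (Ico (0 : ℝ) 1)) ∧
    msupport
        (Measure.map ψb
          (Measure.map (fun t : ℝ => ((Γi t : ℝ) : AddCircle (1 : ℝ)))
            (volume.restrict (Ico (0 : ℝ) 1)))) =
      (fun t : ℝ => Φ t - t) '' Icc (0 : ℝ) 1 := by
  have hΓimono : StrictMono Γi := by
    intro a b hab
    by_contra h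
    have h2 := hΓmono.monotone (not_lt.mp h)
    rw [hΓi₂ a, hΓi₂ b] at h2
    linarith
  have hΓicont : Continuous Γi := hΓimono.monotone.continuous_of_surjective hΓi₁.surjective
  have hkey : ∀ t, Φ (Γi t) = Γi (t + ρ) := by
    intro t
    apply hΓmono.injective
    rw [hconj, hΓi₂, hΓi₂]
  have hΓilift : ∀ t, Γi (t + 1) = Γi t + 1 := by
    intro t
    apply hΓmono.injective
    rw [hΓlift, hΓi₂, hΓi₂]
  have hmeas : Measurable (fun t : ℝ => ((Γi t : ℝ) : AddCircle (1 : ℝ))) :=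
    ((AddCircle.continuous_mk' (1 : ℝ)).comp hΓicont).measurable
  have h1 : Measure.map ψb
        (Measure.map (fun t : ℝ => ((Γi t : ℝ) : AddCircle (1 : ℝ)))
          (volume.restrict (Ico (0 : ℝ) 1))) =
      Measure.map (fun t : ℝ => Γi (t + ρ) - Γi t) (volume.restrict (Ico (0 : ℝ) 1)) := by
    rw [Measure.map_map hψcont.measurable hmeas]
    congr 1
    funext t
    simp only [Function.comp, hψ, hkey]
  refine ⟨h1, ?_⟩
  rw [h1]
  have hΩcont : Continuous (fun t : ℝ => Γi (t + ρ) - Γi t) := by fun_prop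
  have hΩper : Function.Periodic (fun t : ℝ => Γi (t + ρ) - Γi t) 1 := by
    intro t
    have e : t + 1 + ρ = (t + ρ) + 1 := by ring
    simp only [e, hΓilift]
    ring
  have hΨper : Function.Periodic (fun t : ℝ => Φ t - t) 1 := by
    intro t
    simp only [hlift]
    ring
  have hK : IsCompact ((fun t : ℝ => Φ t - t) '' Icc (0 : ℝ) 1) :=
    isCompact_Icc.image (by fun_prop)
  ext y
  constructor
  · intro hy
    by_contra hn
    refine hy _ (hK.isClosed.isOpen_compl.mem_nhds hn) ?_
    rw [Measure.map_apply hΩcont.measurable hK.isClosed.isOpen_compl.measurableSet]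
    have : (fun t : ℝ => Γi (t + ρ) - Γi t) ⁻¹' ((fun t : ℝ => Φ t - t) '' Icc (0 : ℝ) 1)ᶜ = ∅ := by
      rw [Set.eq_empty_iff_forall_notMem]
      intro t ht
      apply ht
      obtain ⟨s, hs, hs'⟩ := hΨper.exists_mem_Ico₀ one_pos (Γi t)
      refine ⟨s, Ico_subset_Icc_self hs, ?_⟩
      simp only [← hkey]
      exact hs'.symm
    rw [this, measure_empty]
  · rintro ⟨s, -, rfl⟩ U hU h0
    obtain ⟨V, hVU, hVo, hV⟩ := mem_nhds_iff.mp hU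
    have hV0 := measure_mono_null hVU h0
    rw [Measure.map_apply hΩcont.measurable hVo.measurableSet] at hV0
    have hO := hVo.preimage hΩcont
    rw [Measure.restrict_apply hO.measurableSet] at hV0
    obtain ⟨t, ht, ht'⟩ := hΩper.exists_mem_Ico₀ one_pos (Γ s)
    have htO : t ∈ (fun t : ℝ => Γi (t + ρ) - Γi t) ⁻¹' V := by
      simp only [← hkey, hΓi₁ s] at ht'
      simp only [Set.mem_preimage, ← hkey, ← ht']
      exact hV
    have hcl : t ∈ closure (Ioo (0 : ℝ) 1) := by
      rw [closure_Ioo (by norm_num)]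
      exact Ico_subset_Icc_self ht
    have hne := mem_closure_iff.mp hcl _ hO htO
    exact (hO.inter isOpen_Ioo).measure_ne_zero volume hne
      (measure_mono_null (inter_subset_inter_right _ Ioo_subset_Ico_self) hV0)
end

section
/- Weak convergence of displacement distributions: Let Φ_n and Φ be lifts of orientation-preserving circle homeomorphisms, all with irrational rotation numbers, such that sup_{x∈ℝ} |Φ_n(x) − Φ(x)| → 0 as n → ∞. Let μ_n and μ be the unique invariant Borel probability measures on ℝ/ℤ of the induced homeomorphisms φ_n and φ respectively. Then the displacement distributions converge weakly: for every bounded continuous function f : ℝ → ℝ, ∫ f d((ψ̄_n)_*μ_n) → ∫ f d(ψ̄_*μ) as n → ∞, where ψ̄_n and ψ̄ are the displacement maps of Φ_n and Φ. -/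
open Filter Set MeasureTheory

namespace DispAux

/-- The representative in `[0,1)`. -/
noncomputable def rep (θ : AddCircle (1 : ℝ)) : ℝ := (AddCircle.measurableEquivIco (1 : ℝ) 0 θ : ℝ)

lemma measurable_rep : Measurable rep :=
  measurable_subtype_coe.comp (AddCircle.measurableEquivIco (1 : ℝ) 0).measurable

lemma coe_rep (θ : AddCircle (1 : ℝ)) : ((rep θ : ℝ) : AddCircle (1 : ℝ)) = θ :=
  AddCircle.coe_equivIco

lemma rep_coe (t : ℝ) : ∃ k : ℤ, rep (t : AddCircle (1 : ℝ)) = t + k := by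
  have h := coe_rep (t : AddCircle (1 : ℝ))
  have h2 : ((rep (t : AddCircle (1 : ℝ)) - t : ℝ) : AddCircle (1 : ℝ)) = 0 := by
    rw [AddCircle.coe_sub, h, sub_self]
  obtain ⟨k, hk⟩ := (AddCircle.coe_eq_zero_iff (1 : ℝ)).1 h2
  refine ⟨k, ?_⟩
  simp at hk
  linarith

/-- The number of lifts of `θ` in `[x,y)`. -/
noncomputable def F (x y : ℝ) (θ : AddCircle (1 : ℝ)) : ℝ :=
  (⌈y - rep θ⌉ : ℝ) - (⌈x - rep θ⌉ : ℝ)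

lemma F_coe (x y t : ℝ) : F x y (t : AddCircle (1 : ℝ)) = (⌈y - t⌉ : ℝ) - (⌈x - t⌉ : ℝ) := by
  obtain ⟨k, hk⟩ := rep_coe t
  unfold F
  rw [hk, show y - (t + k) = (y - t) - k by ring, show x - (t + k) = (x - t) - k by ring,
    Int.ceil_sub_intCast, Int.ceil_sub_intCast]
  push_cast
  ring

lemma measurable_F (x y : ℝ) : Measurable (F x y) := by
  unfold F
  have h : ∀ z : ℝ, Measurable fun θ => (⌈z - rep θ⌉ : ℝ) := fun z =>
    (measurable_from_top (f := fun k : ℤ => (k : ℝ))).comp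
      (Int.measurable_ceil.comp (measurable_const.sub measurable_rep))
  exact (h y).sub (h x)

lemma F_bound (x y : ℝ) (θ) : |F x y θ - (y - x)| ≤ 1 := by
  unfold F
  have h1 := Int.le_ceil (y - rep θ)
  have h2 := Int.ceil_lt_add_one (y - rep θ)
  have h3 := Int.le_ceil (x - rep θ)
  have h4 := Int.ceil_lt_add_one (x - rep θ)
  rw [abs_le]
  constructor <;> linarith

lemma F_nonneg {x y : ℝ} (h : x ≤ y) (θ) : 0 ≤ F x y θ := by
  unfold F
  have : ⌈x - rep θ⌉ ≤ ⌈y - rep θ⌉ := Int.ceil_mono (by linarith)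
  have : (⌈x - rep θ⌉ : ℝ) ≤ ⌈y - rep θ⌉ := by exact_mod_cast this
  linarith

lemma integrable_F (μ : Measure (AddCircle (1 : ℝ))) [IsProbabilityMeasure μ] (x y : ℝ) :
    Integrable (F x y) μ := by
  refine Integrable.of_bound (measurable_F x y).aestronglyMeasurable (1 + |y - x|) ?_
  refine Eventually.of_forall fun θ => ?_
  have := F_bound x y θ
  have h2 := abs_sub_abs_le_abs_sub (F x y θ) (y - x)
  rw [Real.norm_eq_abs]
  linarith

/-- Distribution function. -/
noncomputable def G (μ : Measure (AddCircle (1 : ℝ))) (y : ℝ) : ℝ := ∫ θ, F 0 y θ ∂μ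

section
variable (μ : Measure (AddCircle (1 : ℝ))) [IsProbabilityMeasure μ]

lemma integral_F (x y : ℝ) : ∫ θ, F x y θ ∂μ = G μ y - G μ x := by
  unfold G
  rw [← integral_sub (integrable_F μ _ _) (integrable_F μ _ _)]
  congr 1
  ext θ
  unfold F
  ring

lemma G_mono : Monotone (G μ) := by
  intro x y h
  have := integral_F μ x y
  have h2 : 0 ≤ ∫ θ, F x y θ ∂μ := integral_nonneg (F_nonneg h)
  linarith

lemma G_zero : G μ 0 = 0 := by
  simp [G, F]

lemma G_add_int (y : ℝ) (p : ℤ) : G μ (y + p) = G μ y + p := by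
  have h := integral_F μ y (y + p)
  have : ∀ θ, F y (y + p) θ = p := by
    intro θ
    unfold F
    rw [show y + p - rep θ = (y - rep θ) + p by ring, Int.ceil_add_intCast]
    push_cast
    ring
  simp [this] at h
  linarith

lemma G_bound (y : ℝ) : |G μ y - y| ≤ 1 := by
  have h : G μ y - y = ∫ θ, (F 0 y θ - (y - 0)) ∂μ := by
    rw [integral_sub (integrable_F μ _ _) (integrable_const _)]
    simp [G]
  rw [h, ← Real.norm_eq_abs]
  refine (norm_integral_le_of_norm_le_const (C := 1) (Eventually.of_forall fun θ => ?_)).trans ?_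
  · exact F_bound 0 y θ
  · simp

variable {Φ : ℝ → ℝ} (hmono : StrictMono Φ) (hlift : ∀ x : ℝ, Φ (x + 1) = Φ x + 1)
  {φ : AddCircle (1 : ℝ) → AddCircle (1 : ℝ)}
  (hφ : ∀ x : ℝ, φ (x : AddCircle (1 : ℝ)) = ((Φ x : ℝ) : AddCircle (1 : ℝ)))
  (hinv : Measure.map φ μ = μ)
include hmono hlift

omit μ [IsProbabilityMeasure μ] hmono in
lemma lift_int (x : ℝ) (k : ℤ) : Φ (x + k) = Φ x + k := by
  induction k using Int.induction_on with
  | zero => simp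
  | succ i ih =>
    push_cast at *
    rw [← add_assoc, hlift, ih]
    ring
  | pred i ih =>
    have := hlift (x + ((-(i : ℤ) - 1 : ℤ) : ℝ))
    push_cast at *
    rw [show x + (-(i : ℝ) - 1) + 1 = x + -(i : ℝ) by ring] at this
    linarith

omit μ [IsProbabilityMeasure μ] in
lemma ceil_lift (y t : ℝ) : ⌈Φ y - Φ t⌉ = ⌈y - t⌉ := by
  refine eq_of_forall_ge_iff fun k => ?_
  rw [Int.ceil_le, Int.ceil_le, sub_le_iff_le_add, sub_le_iff_le_add, add_comm, add_comm (k : ℝ) t,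
    ← lift_int hlift, hmono.le_iff_le]

include hφ hinv

lemma G_diff (x y : ℝ) : G μ (Φ y) - G μ (Φ x) = G μ y - G μ x := by
  rw [← integral_F, ← integral_F]
  have hae : AEMeasurable φ μ := by
    by_contra h
    rw [Measure.map_of_not_aemeasurable h] at hinv
    exact IsProbabilityMeasure.ne_zero μ hinv.symm
  calc ∫ θ, F (Φ x) (Φ y) θ ∂μ = ∫ θ, F (Φ x) (Φ y) θ ∂(Measure.map φ μ) := by rw [hinv]
    _ = ∫ θ, F (Φ x) (Φ y) (φ θ) ∂μ :=
        integral_map hae (measurable_F _ _).aestronglyMeasurable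
    _ = ∫ θ, F x y θ ∂μ := by
        congr 1
        ext θ
        induction θ using QuotientAddGroup.induction_on with
        | H t => rw [hφ, F_coe, F_coe, ceil_lift hmono hlift, ceil_lift hmono hlift]

lemma G_iter' (m : ℕ) : G μ (Φ^[m] 0) = m * G μ (Φ 0) := by
  induction m with
  | zero => simp [G_zero]
  | succ m ih =>
    have := G_diff μ hmono hlift hφ hinv 0 (Φ^[m] 0)
    rw [Function.iterate_succ_apply']
    rw [G_zero] at this
    push_cast
    linarith

variable {ρ : ℝ} (hrot : ∀ x : ℝ, Tendsto (fun m : ℕ => Φ^[m] x / m) atTop (nhds ρ))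
include hrot

lemma G_rot : G μ (Φ 0) = ρ := by
  refine tendsto_nhds_unique ?_ (hrot 0)
  rw [tendsto_iff_dist_tendsto_zero]
  refine squeeze_zero' (Eventually.of_forall fun _ => dist_nonneg) ?_
    tendsto_one_div_atTop_nhds_zero_nat
  filter_upwards [eventually_gt_atTop 0] with m hm
  have hm' : (0 : ℝ) < m := by exact_mod_cast hm
  have h := G_bound μ (Φ^[m] 0)
  rw [G_iter' μ hmono hlift hφ hinv] at h
  rw [dist_comm, Real.dist_eq, show G μ (Φ 0) - Φ^[m] 0 / m = (m * G μ (Φ 0) - Φ^[m] 0) / m by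
    field_simp, abs_div, abs_of_pos hm']
  gcongr

lemma G_iter (m : ℕ) : G μ (Φ^[m] 0) = m * ρ := by
  rw [G_iter' μ hmono hlift hφ hinv, G_rot μ hmono hlift hφ hinv hrot]

end

lemma dense_aux {ρ : ℝ} (h : Irrational ρ) {a b : ℝ} (hab : a < b) :
    ∃ (q : ℕ) (p : ℤ), a < q * ρ + p ∧ q * ρ + p < b := by
  haveI : Fact ((0 : ℝ) < 1) := ⟨one_pos⟩
  have h1 : DenseRange fun n : ℤ => n • ((ρ : ℝ) : AddCircle (1 : ℝ)) :=
    AddCircle.denseRange_zsmul_coe_iff.2 (by simpa using h)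
  have h2 := denseRange_zsmul_iff_nsmul.1 h1
  have ho : IsOpen ((fun t : ℝ => (t : AddCircle (1 : ℝ))) '' Ioo a b) :=
    QuotientAddGroup.isOpenMap_coe _ isOpen_Ioo
  obtain ⟨q, t, ht, hq⟩ := h2.exists_mem_open ho ((nonempty_Ioo.2 hab).image _)
  have h3 : ((t - q * ρ : ℝ) : AddCircle (1 : ℝ)) = 0 := by
    rw [AddCircle.coe_sub]
    simp only at hq
    rw [hq, ← AddCircle.coe_nsmul, nsmul_eq_mul, sub_self]
  obtain ⟨p, hp⟩ := (AddCircle.coe_eq_zero_iff (1 : ℝ)).1 h3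
  simp at hp
  refine ⟨q, p, ?_, ?_⟩ <;> [have := ht.1; have := ht.2] <;> linarith

lemma approx (g : AddCircle (1 : ℝ) → ℝ) (hg : Continuous g) {ε : ℝ} (hε : 0 < ε) :
    ∃ k : ℕ, ∀ (ν : Measure (AddCircle (1 : ℝ))) [IsProbabilityMeasure ν],
      |∫ θ, g θ ∂ν - ∑ i ∈ Finset.range k, g (((i : ℝ) / k : ℝ) : AddCircle (1 : ℝ)) *
        (G ν ((i + 1 : ℕ) / k) - G ν (i / k))| ≤ ε := by
  haveI : Fact ((0 : ℝ) < 1) := ⟨one_pos⟩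
  have hu := CompactSpace.uniformContinuous_of_continuous hg
  have huc : ∃ δ > 0, ∀ s t : ℝ, |s - t| < δ →
      |g (s : AddCircle (1 : ℝ)) - g (t : AddCircle (1 : ℝ))| < ε := by
    obtain ⟨δ, hδ, h⟩ := Metric.uniformContinuous_iff.1 hu ε hε
    refine ⟨δ, hδ, fun s t hst => ?_⟩
    rw [← Real.dist_eq]
    refine h ?_
    rw [dist_eq_norm, ← AddCircle.coe_sub]
    exact (QuotientAddGroup.norm_mk_le_norm (S := AddSubgroup.zmultiples (1 : ℝ)) (m := s - t)).trans_lt hst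
  obtain ⟨δ, hδ, h⟩ := huc
  obtain ⟨k0, hk0⟩ := exists_nat_one_div_lt hδ
  obtain ⟨k, hk⟩ : ∃ k : ℕ, k = k0 + 1 := ⟨_, rfl⟩
  have hkpos : (0 : ℝ) < k := by rw [hk]; positivity
  have hkδ : 1 / (k : ℝ) < δ := by rw [hk]; push_cast; exact hk0
  refine ⟨k, fun ν _ => ?_⟩
  have hgi : Integrable g ν := by
    obtain ⟨C, hC⟩ := isCompact_univ.exists_bound_of_continuousOn hg.continuousOn
    exact Integrable.of_bound hg.aestronglyMeasurable C
      (Eventually.of_forall fun θ => hC θ (mem_univ _))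
  simp_rw [← integral_F, ← integral_const_mul]
  have hFi : ∀ i ∈ Finset.range k, Integrable (fun θ => g (((i : ℝ) / k : ℝ) : AddCircle (1 : ℝ)) *
      F (i / k) ((i + 1 : ℕ) / k) θ) ν := fun i _ => (integrable_F ν _ _).const_mul _
  rw [← integral_finsetSum _ hFi, ← integral_sub hgi (integrable_finsetSum _ hFi),
    ← Real.norm_eq_abs]
  refine (norm_integral_le_of_norm_le_const (C := ε) (Eventually.of_forall fun θ => ?_)).trans ?_
  swap
  · simp
  have hsum : ∑ i ∈ Finset.range k, F (i / k) ((i + 1 : ℕ) / k) θ = 1 := by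
    unfold F
    rw [Finset.sum_range_sub (fun i : ℕ => (⌈(i : ℝ) / k - rep θ⌉ : ℝ))]
    rw [div_self hkpos.ne', show (1 : ℝ) - rep θ = -rep θ + 1 by ring, Int.ceil_add_one]
    simp
  have hle : ∀ i ∈ Finset.range k,
      |(g θ - g (((i : ℝ) / k : ℝ) : AddCircle (1 : ℝ))) * F (i / k) ((i + 1 : ℕ) / k) θ| ≤
        ε * F (i / k) ((i + 1 : ℕ) / k) θ := by
    intro i _
    have hstep : ((i + 1 : ℕ) : ℝ) / k = i / k + 1 / k := by push_cast; ring
    have hnn : 0 ≤ F (i / k) ((i + 1 : ℕ) / k) θ := F_nonneg (by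
      rw [hstep]; have : 0 < 1 / (k : ℝ) := by positivity
      linarith) θ
    rw [abs_mul, abs_of_nonneg hnn]
    rcases hnn.eq_or_lt with h0 | h0
    · rw [← h0]; simp
    refine mul_le_mul_of_nonneg_right ?_ hnn
    set j := ⌈(i : ℝ) / k - rep θ⌉ with hj
    have h1 : (i : ℝ) / k - rep θ ≤ j := Int.le_ceil _
    have h2 : (j : ℝ) < ((i + 1 : ℕ) : ℝ) / k - rep θ := by
      rw [← Int.lt_ceil]
      unfold F at h0
      rw [sub_pos] at h0
      exact_mod_cast h0
    have h3 : ((rep θ + j : ℝ) : AddCircle (1 : ℝ)) = θ := by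
      rw [AddCircle.coe_add, coe_rep]
      have : ((j : ℝ) : AddCircle (1 : ℝ)) = 0 :=
        (AddCircle.coe_eq_zero_iff (1 : ℝ)).2 ⟨j, by simp⟩
      rw [this, add_zero]
    rw [← h3]
    refine (h _ _ ?_).le
    rw [abs_lt]
    rw [hstep] at h2
    constructor <;> linarith
  have heq : g θ - ∑ i ∈ Finset.range k, g (((i : ℝ) / k : ℝ) : AddCircle (1 : ℝ)) *
      F (i / k) ((i + 1 : ℕ) / k) θ = ∑ i ∈ Finset.range k,
        (g θ - g (((i : ℝ) / k : ℝ) : AddCircle (1 : ℝ))) * F (i / k) ((i + 1 : ℕ) / k) θ := by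
    simp_rw [sub_mul]
    rw [Finset.sum_sub_distrib, ← Finset.mul_sum, hsum, mul_one]
  rw [heq, Real.norm_eq_abs]
  refine (Finset.abs_sum_le_sum_abs _ _).trans ((Finset.sum_le_sum hle).trans ?_)
  rw [← Finset.mul_sum, hsum, mul_one]

lemma weak_of_G (ν : ℕ → Measure (AddCircle (1 : ℝ))) (μ : Measure (AddCircle (1 : ℝ)))
    [∀ n, IsProbabilityMeasure (ν n)] [IsProbabilityMeasure μ]
    (h : ∀ y, Tendsto (fun n => G (ν n) y) atTop (nhds (G μ y)))
    (g : AddCircle (1 : ℝ) → ℝ) (hg : Continuous g) :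
    Tendsto (fun n => ∫ θ, g θ ∂(ν n)) atTop (nhds (∫ θ, g θ ∂μ)) := by
  rw [Metric.tendsto_nhds]
  intro ε hε
  obtain ⟨k, hk⟩ := approx g hg (show 0 < ε / 3 by positivity)
  have hs : Tendsto (fun n => ∑ i ∈ Finset.range k, g (((i : ℝ) / k : ℝ) : AddCircle (1 : ℝ)) *
        (G (ν n) ((i + 1 : ℕ) / k) - G (ν n) (i / k))) atTop
      (nhds (∑ i ∈ Finset.range k, g (((i : ℝ) / k : ℝ) : AddCircle (1 : ℝ)) *
        (G μ ((i + 1 : ℕ) / k) - G μ (i / k)))) :=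
    tendsto_finsetSum _ fun i _ => ((h _).sub (h _)).const_mul _
  filter_upwards [Metric.tendsto_nhds.1 hs (ε / 3) (by positivity)] with n hn
  have h1 := abs_le.1 (hk (ν n))
  have h2 := abs_le.1 (hk μ)
  rw [Real.dist_eq] at *
  rw [abs_lt] at *
  constructor <;> linarith [h1.1, h1.2, h2.1, h2.2, hn.1, hn.2]

end DispAux

/-- Weak convergence of displacement distributions: if lifts `Φₙ` of
circle homeomorphisms with irrational rotation numbers converge uniformly to `Φ` (also
with irrational rotation number), then the displacement distributions of the unique
invariant measures converge weakly. -/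
theorem displacement_distributions_converge_weakly
    (Φseq : ℕ → ℝ → ℝ) (Φ : ℝ → ℝ)
    (hcontn : ∀ n, Continuous (Φseq n)) (hmonon : ∀ n, StrictMono (Φseq n))
    (hbijn : ∀ n, Function.Bijective (Φseq n))
    (hliftn : ∀ n, ∀ x : ℝ, Φseq n (x + 1) = Φseq n x + 1)
    (ρseq : ℕ → ℝ) (hirrn : ∀ n, Irrational (ρseq n))
    (hrotn : ∀ n, ∀ x : ℝ,
      Tendsto (fun m : ℕ => (Φseq n)^[m] x / m) atTop (nhds (ρseq n)))
    (hcont : Continuous Φ) (hmono : StrictMono Φ)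
    (hbij : Function.Bijective Φ) (hlift : ∀ x : ℝ, Φ (x + 1) = Φ x + 1)
    (ρ : ℝ) (hirr : Irrational ρ)
    (hrot : ∀ x : ℝ, Tendsto (fun m : ℕ => Φ^[m] x / m) atTop (nhds ρ))
    (hunif : TendstoUniformly Φseq Φ atTop)
    (φseq : ℕ → AddCircle (1 : ℝ) → AddCircle (1 : ℝ))
    (φ : AddCircle (1 : ℝ) → AddCircle (1 : ℝ))
    (hφn : ∀ n, ∀ x : ℝ, φseq n (x : AddCircle (1 : ℝ)) = ((Φseq n x : ℝ) : AddCircle (1 : ℝ)))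
    (hφ : ∀ x : ℝ, φ (x : AddCircle (1 : ℝ)) = ((Φ x : ℝ) : AddCircle (1 : ℝ)))
    (μseq : ℕ → Measure (AddCircle (1 : ℝ))) (μ : Measure (AddCircle (1 : ℝ)))
    (hprobn : ∀ n, IsProbabilityMeasure (μseq n)) (hprob : IsProbabilityMeasure μ)
    (hinvn : ∀ n, Measure.map (φseq n) (μseq n) = μseq n)
    (hinv : Measure.map φ μ = μ)
    (ψbseq : ℕ → AddCircle (1 : ℝ) → ℝ) (ψb : AddCircle (1 : ℝ) → ℝ)
    (hψbn : ∀ n, Continuous (ψbseq n))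
    (hψn : ∀ n, ∀ x : ℝ, ψbseq n (x : AddCircle (1 : ℝ)) = Φseq n x - x)
    (hψbcont : Continuous ψb)
    (hψ : ∀ x : ℝ, ψb (x : AddCircle (1 : ℝ)) = Φ x - x) :
    ∀ f : ℝ → ℝ, Continuous f → (∃ C : ℝ, ∀ y : ℝ, |f y| ≤ C) →
      Tendsto (fun n : ℕ => ∫ y, f y ∂(Measure.map (ψbseq n) (μseq n))) atTop
        (nhds (∫ y, f y ∂(Measure.map ψb μ))) := by
  haveI := hprobn
  intro f hf hfb
  -- iterates converge
  have hiter : ∀ m : ℕ, Tendsto (fun n => (Φseq n)^[m] 0) atTop (nhds (Φ^[m] 0)) := by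
    intro m
    induction m with
    | zero => simp
    | succ m ih =>
      simp_rw [Function.iterate_succ_apply']
      exact hunif.tendsto_comp hcont.continuousAt ih
  have hGn : ∀ n m, DispAux.G (μseq n) ((Φseq n)^[m] 0) = m * ρseq n := fun n m =>
    DispAux.G_iter (μseq n) (hmonon n) (hliftn n) (hφn n) (hinvn n) (hrotn n) m
  have hG : ∀ m, DispAux.G μ (Φ^[m] 0) = m * ρ := fun m =>
    DispAux.G_iter μ hmono hlift hφ hinv hrot m
  -- rotation numbers converge
  have hρ : Tendsto ρseq atTop (nhds ρ) := by
    rw [Metric.tendsto_nhds]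
    intro ε hε
    obtain ⟨m, hm⟩ := exists_nat_gt (3 / ε)
    have hm0 : (0 : ℝ) < m := lt_trans (by positivity) hm
    have hm3 : 3 < m * ε := by rwa [div_lt_iff₀ hε] at hm
    filter_upwards [Metric.tendsto_nhds.1 (hiter m) 1 one_pos] with n hn
    have h1 := abs_le.1 (DispAux.G_bound (μseq n) ((Φseq n)^[m] 0))
    have h2 := abs_le.1 (DispAux.G_bound μ (Φ^[m] 0))
    rw [hGn] at h1
    rw [hG] at h2
    rw [Real.dist_eq] at *
    rw [abs_lt] at *
    constructor
    · refine lt_of_mul_lt_mul_left (a := (m : ℝ)) ?_ hm0.le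
      linarith [h1.1, h1.2, h2.1, h2.2, hn.1, hn.2]
    · refine lt_of_mul_lt_mul_left (a := (m : ℝ)) ?_ hm0.le
      linarith [h1.1, h1.2, h2.1, h2.2, hn.1, hn.2]
  have hGconv : ∀ y, Tendsto (fun n => DispAux.G (μseq n) y) atTop (nhds (DispAux.G μ y)) := by
    intro y
    rw [tendsto_order]
    constructor
    · intro a ha
      obtain ⟨q, p, h1, h2⟩ := DispAux.dense_aux hirr ha
      have hlt : Φ^[q] 0 + p < y := by
        by_contra hc
        have := DispAux.G_mono μ (not_lt.1 hc)
        rw [DispAux.G_add_int, hG] at this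
        linarith
      filter_upwards [((hiter q).add_const (p : ℝ)).eventually_lt_const hlt,
        ((hρ.const_mul (q : ℝ)).add_const (p : ℝ)).eventually_const_lt h1] with n hn1 hn2
      have := DispAux.G_mono (μseq n) hn1.le
      rw [DispAux.G_add_int, hGn] at this
      linarith
    · intro a ha
      obtain ⟨q, p, h1, h2⟩ := DispAux.dense_aux hirr ha
      have hlt : y < Φ^[q] 0 + p := by
        by_contra hc
        have := DispAux.G_mono μ (not_lt.1 hc)
        rw [DispAux.G_add_int, hG] at this
        linarith
      filter_upwards [((hiter q).add_const (p : ℝ)).eventually_const_lt hlt,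
        ((hρ.const_mul (q : ℝ)).add_const (p : ℝ)).eventually_lt_const h2] with n hn1 hn2
      have := DispAux.G_mono (μseq n) hn1.le
      rw [DispAux.G_add_int, hGn] at this
      linarith
  have hweak := DispAux.weak_of_G μseq μ hGconv (fun θ => f (ψb θ)) (hf.comp hψbcont)
  have hmapn : ∀ n, ∫ y, f y ∂(Measure.map (ψbseq n) (μseq n)) = ∫ θ, f (ψbseq n θ) ∂(μseq n) :=
    fun n => integral_map (hψbn n).measurable.aemeasurable hf.aestronglyMeasurable
  have hmap : ∫ y, f y ∂(Measure.map ψb μ) = ∫ θ, f (ψb θ) ∂μ :=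
    integral_map hψbcont.measurable.aemeasurable hf.aestronglyMeasurable
  rw [hmap]
  simp_rw [hmapn]
  haveI : Fact ((0 : ℝ) < 1) := ⟨one_pos⟩
  obtain ⟨C, hC⟩ := hfb
  have hint : ∀ n (u : AddCircle (1 : ℝ) → ℝ), Continuous u →
      Integrable (fun θ => f (u θ)) (μseq n) := fun n u hu =>
    Integrable.of_bound (hf.comp hu).aestronglyMeasurable C
      (Eventually.of_forall fun θ => hC _)
  have hdiff : Tendsto (fun n => ∫ θ, f (ψbseq n θ) ∂(μseq n) - ∫ θ, f (ψb θ) ∂(μseq n)) atTop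
      (nhds 0) := by
    obtain ⟨B, hB⟩ := isCompact_univ.exists_bound_of_continuousOn hψbcont.continuousOn
    have huc : UniformContinuousOn f (Icc (-(B + 1)) (B + 1)) :=
      isCompact_Icc.uniformContinuousOn_of_continuous hf.continuousOn
    rw [Metric.tendsto_nhds]
    intro ε hε
    obtain ⟨δ, hδ, hd⟩ := Metric.uniformContinuousOn_iff.1 huc (ε / 2) (by positivity)
    filter_upwards [Metric.tendstoUniformly_iff.1 hunif (min δ 1) (by positivity)] with n hn
    rw [← integral_sub (hint n _ (hψbn n)) (hint n _ hψbcont), dist_zero_right]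
    refine lt_of_le_of_lt (norm_integral_le_of_norm_le_const (C := ε / 2)
      (Eventually.of_forall fun θ => ?_)) (by simp; linarith)
    have hb := hB θ (mem_univ _)
    have hclose : |ψbseq n θ - ψb θ| < min δ 1 := by
      induction θ using QuotientAddGroup.induction_on with
      | H t =>
        rw [hψn, hψ]
        have := hn t
        rw [dist_comm, Real.dist_eq] at this
        rwa [sub_sub_sub_cancel_right]
    rw [Real.norm_eq_abs, abs_le] at hb
    have hc1 := abs_lt.1 (hclose.trans_le (min_le_right _ _))
    rw [← dist_eq_norm]
    refine (hd _ ⟨?_, ?_⟩ _ ⟨?_, ?_⟩ ?_).le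
    · linarith [hc1.1]
    · linarith [hc1.2]
    · linarith [hb.1]
    · linarith [hb.2]
    · rw [Real.dist_eq]
      exact hclose.trans_le (min_le_left _ _)
  simpa using hdiff.add hweak
end

section
/- Let Φ be a continuously differentiable lift of an orientation-preserving circle diffeomorphism (Φ′ continuous and positive) with irrational rotation number ρ = ρ(Φ), and let Γ be a lift of a conjugacy of Φ with the translation by ρ which is a C¹-diffeomorphism of ℝ (Γ and Γ⁻¹ continuously differentiable). Assume the set C = {x ∈ [0,1] : Φ′(x) = 1} of critical points of the displacement function Ψ = Φ − id has Lebesgue measure zero. Let μ be the φ-invariant probability measure on ℝ/ℤ with density Γ′ with respect to Lebesgue measure. Then the displacement distribution μ_Ψ = ψ̄_*μ is absolutely continuous with respect to Lebesgue measure on ℝ. -/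
open Filter Set MeasureTheory

/-- A null set has null preimage under a `C¹` function, away from critical points. -/
theorem preimage_null_aux (f f' : ℝ → ℝ) (hf : ∀ x, HasDerivAt f (f' x) x)
    (hf' : Continuous f') (N : Set ℝ) (hNm : MeasurableSet N) (hN : volume N = 0) :
    volume (f ⁻¹' N ∩ {x | f' x ≠ 0}) = 0 := by
  have hfc : Continuous f := continuous_iff_continuousAt.2 fun x => (hf x).continuousAt
  refine measure_null_of_locally_null _ fun x hx => ?_
  have hx0 : f' x ≠ 0 := hx.2
  have hs : HasStrictDerivAt f (f' x) x :=
    hasStrictDerivAt_of_hasDerivAt_of_continuousAt (Eventually.of_forall hf) hf'.continuousAt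
  have hs2 := hs.hasStrictFDerivAt_equiv hx0
  set e := hs2.toOpenPartialHomeomorph f with he
  have hxe : x ∈ e.source := hs2.mem_toOpenPartialHomeomorph_source
  have hinj : InjOn f e.source := e.injOn
  set t := e.source ∩ (f ⁻¹' N ∩ {x | f' x ≠ 0}) with ht
  have hm0 : MeasurableSet {x | f' x ≠ 0} := (isOpen_ne_fun hf' continuous_const).measurableSet
  have htm : MeasurableSet t :=
    e.open_source.measurableSet.inter ((hfc.measurable hNm).inter hm0)
  refine ⟨t, (by rw [ht, inter_comm e.source]; exact inter_mem_nhdsWithin _ (e.open_source.mem_nhds hxe)), ?_⟩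
  have h1 := lintegral_abs_det_fderiv_eq_addHaar_image volume htm
    (fun y _ => (hf y).hasFDerivAt.hasFDerivWithinAt) (hinj.mono inter_subset_left)
  have h2 : volume (f '' t) = 0 :=
    measure_mono_null (by rintro _ ⟨y, hy, rfl⟩; exact hy.2.1) hN
  simp only [ContinuousLinearMap.det_toSpanSingleton] at h1
  rw [h2, lintegral_eq_zero_iff (by fun_prop)] at h1
  rw [← Measure.restrict_apply_univ, Measure.measure_univ_eq_zero]
  rw [← ae_eq_bot]
  by_contra hne
  have : (ae (volume.restrict t)).NeBot := ⟨hne⟩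
  obtain ⟨y, hy1, hy2⟩ := (h1.and (ae_restrict_mem htm)).exists
  have : f' y ≠ 0 := hy2.2.2
  simp at hy1
  exact this hy1

/-- If `Φ` is a `C¹` lift of a circle diffeomorphism with irrational
rotation number `ρ`, the conjugacy `Γ` with the translation by `ρ` is a
`C¹`-diffeomorphism, and the critical set `{x ∈ [0,1] : Φ' x = 1}` of the displacement
`Ψ = Φ - id` has Lebesgue measure zero, then the displacement distribution
`μ_Ψ = ψ̄_*μ` of the invariant measure `μ` with density `Γ'` is absolutely continuous
with respect to Lebesgue measure. -/
theorem displacement_distribution_absolutely_continuous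
    (Φ Φ' : ℝ → ℝ) (hΦderiv : ∀ x : ℝ, HasDerivAt Φ (Φ' x) x)
    (hΦ'cont : Continuous Φ') (hΦ'pos : ∀ x : ℝ, 0 < Φ' x)
    (hmono : StrictMono Φ) (hbij : Function.Bijective Φ)
    (hlift : ∀ x : ℝ, Φ (x + 1) = Φ x + 1)
    (ρ : ℝ) (hirr : Irrational ρ)
    (hrot : ∀ x : ℝ, Tendsto (fun n : ℕ => Φ^[n] x / n) atTop (nhds ρ))
    (Γ Γ' : ℝ → ℝ) (hΓderiv : ∀ x : ℝ, HasDerivAt Γ (Γ' x) x)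
    (hΓ'cont : Continuous Γ') (hΓ'pos : ∀ x : ℝ, 0 < Γ' x)
    (hΓmono : StrictMono Γ) (hΓbij : Function.Bijective Γ)
    (hΓlift : ∀ x : ℝ, Γ (x + 1) = Γ x + 1)
    (hconj : ∀ x : ℝ, Γ (Φ x) = Γ x + ρ)
    (hC : volume {x ∈ Icc (0 : ℝ) 1 | Φ' x = 1} = 0)
    (φ : AddCircle (1 : ℝ) → AddCircle (1 : ℝ))
    (hφ : ∀ x : ℝ, φ (x : AddCircle (1 : ℝ)) = ((Φ x : ℝ) : AddCircle (1 : ℝ)))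
    (ψb : AddCircle (1 : ℝ) → ℝ) (hψcont : Continuous ψb)
    (hψ : ∀ x : ℝ, ψb (x : AddCircle (1 : ℝ)) = Φ x - x) :
    Measure.map ψb
        (Measure.map (fun t : ℝ => (t : AddCircle (1 : ℝ)))
          ((volume.restrict (Ico (0 : ℝ) 1)).withDensity
            (fun t => ENNReal.ofReal (Γ' t)))) ≪ (volume : Measure ℝ) := by
  have hqm : Measurable (fun t : ℝ => (t : AddCircle (1 : ℝ))) :=
    (AddCircle.continuous_mk' 1).measurable
  rw [Measure.map_map hψcont.measurable hqm]
  have hcomp : ψb ∘ (fun t : ℝ => (t : AddCircle (1 : ℝ))) = fun x => Φ x - x := funext hψ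
  rw [hcomp]
  have hd : ∀ x, HasDerivAt (fun x => Φ x - x) (Φ' x - 1) x :=
    fun x => (hΦderiv x).sub (hasDerivAt_id x)
  have hcont : Continuous (fun x => Φ x - x) :=
    continuous_iff_continuousAt.2 fun x => (hd x).continuousAt
  refine Measure.AbsolutelyContinuous.mk fun N hNm hN => ?_
  rw [Measure.map_apply hcont.measurable hNm]
  refine withDensity_absolutelyContinuous _ _ ?_
  rw [Measure.restrict_apply (hcont.measurable hNm)]
  have h := preimage_null_aux _ _ hd (hΦ'cont.sub continuous_const) N hNm hN
  refine measure_mono_null ?_ (measure_union_null h hC)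
  rintro x ⟨hx1, hx2⟩
  by_cases hx : Φ' x = 1
  · exact Or.inr ⟨Ico_subset_Icc_self hx2, hx⟩
  · exact Or.inl ⟨hx1, sub_ne_zero.2 hx⟩
end

section
/- Effective formula for the displacement density: Let Φ be a continuously differentiable lift of an orientation-preserving circle diffeomorphism with irrational rotation number ρ = ρ(Φ) and minimal induced homeomorphism φ, let Γ be a lift of a conjugacy of Φ with the translation by ρ which is a C¹-diffeomorphism of ℝ, and assume the critical set C = {x ∈ [0,1] : Φ′(x) = 1} of Ψ = Φ − id has Lebesgue measure zero. Let μ be the φ-invariant probability measure with density Γ′ and μ_Ψ = ψ̄_*μ its displacement distribution. Then μ_Ψ has a density Δ with respect to Lebesgue measure on ℝ which satisfies: Δ(y) = 0 for y outside Ψ([0,1]), and Δ(y) = Σ_{x ∈ Ψ⁻¹(y)∩[0,1)} Γ′(x)/|Φ′(x) − 1| (a finite sum) for Lebesgue-almost every y ∈ Ψ([0,1]) that is not a critical value of Ψ; i.e. μ_Ψ(A) = ∫_A Δ(y) dy for every Borel set A ⊆ ℝ. -/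
open Filter Set MeasureTheory

lemma aux_pieces (f f' : ℝ → ℝ) (hf : ∀ x, HasDerivAt f (f' x) x) (hc : Continuous f') :
    ∃ s : ℕ → Set ℝ, (∀ i, MeasurableSet (s i)) ∧ Pairwise (Function.onFun Disjoint s) ∧
      (⋃ i, s i) = {x ∈ Ico (0 : ℝ) 1 | f' x ≠ 0} ∧ ∀ i, InjOn f (s i) := by
  classical
  let e : ℕ ≃ ℚ × ℚ := (Denumerable.eqv (ℚ × ℚ)).symm
  let V : ℕ → Set ℝ := fun n =>
    if ∀ x ∈ Ioo ((e n).1 : ℝ) ((e n).2 : ℝ), f' x ≠ 0 then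
      Ioo ((e n).1 : ℝ) ((e n).2 : ℝ) else ∅
  have hVm : ∀ n, MeasurableSet (V n) := by
    intro n
    simp only [V]
    split_ifs
    · exact measurableSet_Ioo
    · exact MeasurableSet.empty
  have hVU : (⋃ n, V n) = {x | f' x ≠ 0} := by
    ext x
    simp only [mem_iUnion, mem_ofPred_eq]
    constructor
    · rintro ⟨n, hn⟩
      simp only [V] at hn
      split_ifs at hn with h
      · exact h x hn
      · exact absurd hn (notMem_empty x)
    · intro hx
      have hopen : IsOpen {x | f' x ≠ 0} := isOpen_ne_fun hc continuous_const
      obtain ⟨ε, hε, hb⟩ := Metric.isOpen_iff.1 hopen x hx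
      obtain ⟨p, hp1, hp2⟩ := exists_rat_btwn (show x - ε < x by linarith)
      obtain ⟨q, hq1, hq2⟩ := exists_rat_btwn (show x < x + ε by linarith)
      refine ⟨e.symm (p, q), ?_⟩
      have hall : ∀ z ∈ Ioo (p : ℝ) (q : ℝ), f' z ≠ 0 := by
        intro z hz
        apply hb
        rw [Real.ball_eq_Ioo]
        exact ⟨by linarith [hz.1], by linarith [hz.2]⟩
      simp only [V, Equiv.apply_symm_apply]
      rw [if_pos hall]
      exact ⟨hp2, hq1⟩
  have hVinj : ∀ n, InjOn f (V n) := by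
    intro n
    simp only [V]
    split_ifs with h
    · have key : ∀ a ∈ Ioo ((e n).1 : ℝ) ((e n).2 : ℝ), ∀ b ∈ Ioo ((e n).1 : ℝ) ((e n).2 : ℝ),
          a < b → f a ≠ f b := by
        intro a ha b hb hab heq
        obtain ⟨c, hc1, hc2⟩ := exists_hasDerivAt_eq_zero hab
          (fun x _ => (hf x).continuousAt.continuousWithinAt) heq (fun x _ => hf x)
        exact h c ⟨ha.1.trans hc1.1, hc1.2.trans hb.2⟩ hc2
      intro a ha b hb hab
      rcases lt_trichotomy a b with hlt | heq | hgt
      · exact absurd hab (key a ha b hb hlt)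
      · exact heq
      · exact absurd hab.symm (key b hb a ha hgt)
    · exact injOn_empty f
  refine ⟨fun n => Ico (0 : ℝ) 1 ∩ disjointed V n, ?_, ?_, ?_, ?_⟩
  · intro i
    exact measurableSet_Ico.inter (MeasurableSet.disjointed hVm i)
  · intro i j hij
    exact (disjoint_disjointed V hij).mono inter_subset_right inter_subset_right
  · rw [← inter_iUnion, iUnion_disjointed, hVU]
    rfl
  · intro i
    exact (hVinj i).mono (inter_subset_right.trans (disjointed_subset V i))

lemma aux_density (f f' w : ℝ → ℝ) (hf : ∀ x, HasDerivAt f (f' x) x) (hc : Continuous f')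
    (hw : Continuous w)
    (hC : volume {x ∈ Icc (0 : ℝ) 1 | f' x = 0} = 0) :
    ∃ H : ℝ → ENNReal, Measurable H ∧
      Measure.map f ((volume.restrict (Ico (0 : ℝ) 1)).withDensity
        (fun t => ENNReal.ofReal (w t))) = volume.withDensity H ∧
      ∀ y, H y = ∑' x : ℝ, indicator {x ∈ Ico (0 : ℝ) 1 | f' x ≠ 0 ∧ f x = y}
        (fun x => ENNReal.ofReal (w x / |f' x|)) x := by
  classical
  obtain ⟨s, hsm, hsd, hsU, hsi⟩ := aux_pieces f f' hf hc
  have hfc : Continuous f := continuous_iff_continuousAt.2 fun x => (hf x).continuousAt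
  let v : ℝ → ENNReal := fun x => ENNReal.ofReal (w x / |f' x|)
  have hvm : Measurable v := (hw.measurable.div hc.abs.measurable).ennreal_ofReal
  have hemb : ∀ i, MeasurableEmbedding ((s i).domRestrict f) := fun i =>
    hfc.continuousOn.measurableEmbedding (hsm i) (hsi i)
  let h : ℕ → ℝ → ENNReal := fun i => Function.extend ((s i).domRestrict f) ((s i).domRestrict v) 0
  have hhm : ∀ i, Measurable (h i) := fun i =>
    (hemb i).measurable_extend (hvm.comp measurable_subtype_coe) measurable_const
  have hh1 : ∀ i, ∀ x ∈ s i, h i (f x) = v x := fun i x hx =>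
    (hemb i).injective.extend_apply ((s i).domRestrict v) 0 ⟨x, hx⟩
  have hh0 : ∀ i y, y ∉ f '' s i → h i y = 0 := by
    intro i y hy
    refine Function.extend_apply' _ _ _ ?_
    rintro ⟨⟨x, hx⟩, rfl⟩
    exact hy ⟨x, hx, rfl⟩
  have hne : ∀ i, ∀ x ∈ s i, f' x ≠ 0 := by
    intro i x hx
    have : x ∈ ⋃ i, s i := mem_iUnion.2 ⟨i, hx⟩
    rw [hsU] at this
    exact this.2
  refine ⟨fun y => ∑' i, h i y, Measurable.tsum hhm, ?_, ?_⟩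
  · ext A hA
    rw [Measure.map_apply hfc.measurable hA, withDensity_apply _ (hfc.measurable hA),
      withDensity_apply _ hA, lintegral_tsum (fun i => (hhm i).aemeasurable),
      Measure.restrict_restrict (hfc.measurable hA)]
    have hae : (f ⁻¹' A ∩ Ico (0 : ℝ) 1 : Set ℝ) =ᵐ[volume] ⋃ i, (s i ∩ f ⁻¹' A) := by
      rw [← iUnion_inter, hsU]
      have : ∀ᵐ x : ℝ, x ∉ {x ∈ Icc (0 : ℝ) 1 | f' x = 0} := measure_eq_zero_iff_ae_notMem.1 hC
      filter_upwards [this] with x hx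
      apply propext
      change (x ∈ f ⁻¹' A ∩ Ico (0 : ℝ) 1) ↔ (x ∈ {x ∈ Ico (0 : ℝ) 1 | f' x ≠ 0} ∩ f ⁻¹' A)
      constructor
      · rintro ⟨h1, h2⟩
        exact ⟨⟨h2, fun h3 => hx ⟨Ico_subset_Icc_self h2, h3⟩⟩, h1⟩
      · rintro ⟨⟨h1, _⟩, h2⟩
        exact ⟨h2, h1⟩
    rw [Measure.restrict_congr_set hae, lintegral_iUnion
      (fun i => (hsm i).inter (hfc.measurable hA))
      (fun i j hij => (hsd hij).mono inter_subset_left inter_subset_left)]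
    refine tsum_congr fun i => ?_
    have hmi := (hsm i).inter (hfc.measurable hA)
    have himg := lintegral_image_eq_lintegral_abs_deriv_mul hmi
      (fun x _ => (hf x).hasDerivWithinAt) ((hsi i).mono inter_subset_left) (h i)
    have hind : ∫⁻ y in A, h i y = ∫⁻ y in f '' (s i ∩ f ⁻¹' A), h i y := by
      have hmim : MeasurableSet (f '' (s i ∩ f ⁻¹' A)) :=
        hmi.image_of_continuousOn_injOn hfc.continuousOn ((hsi i).mono inter_subset_left)
      rw [← lintegral_indicator hA, ← lintegral_indicator hmim]
      refine lintegral_congr fun y => ?_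
      rw [image_inter_preimage]
      by_cases hy : y ∈ f '' s i
      · by_cases hyA : y ∈ A
        · rw [indicator_of_mem hyA, indicator_of_mem (show y ∈ f '' s i ∩ A from ⟨hy, hyA⟩)]
        · rw [indicator_of_notMem hyA, indicator_of_notMem (fun hh => hyA hh.2)]
      · rw [indicator_of_notMem (show y ∉ f '' s i ∩ A from fun hh => hy hh.1), indicator_apply, hh0 i y hy, ite_self]
    rw [hind, himg]
    refine setLIntegral_congr_fun hmi ?_
    intro x hx
    have hpos : 0 < |f' x| := abs_pos.2 (hne i x hx.1)
    simp only [hh1 i x hx.1, v]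
    rw [← ENNReal.ofReal_mul hpos.le, mul_div_cancel₀ _ hpos.ne']
  · intro y
    have hstep : ∀ i, h i y = ∑' x : ℝ, indicator (s i ∩ f ⁻¹' {y}) v x := by
      intro i
      by_cases hy : y ∈ f '' s i
      · obtain ⟨x, hx, rfl⟩ := hy
        rw [tsum_eq_single x, indicator_of_mem (show x ∈ s i ∩ f ⁻¹' {f x} from ⟨hx, rfl⟩),
          hh1 i x hx]
        intro z hz
        exact indicator_of_notMem (fun hh => hz (hsi i hh.1 hx hh.2)) _
      · rw [hh0 i y hy, eq_comm, ENNReal.tsum_eq_zero]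
        intro x
        exact indicator_of_notMem (fun hh => hy ⟨x, hh.1, hh.2⟩) _
    simp only [hstep]
    rw [ENNReal.tsum_comm]
    refine tsum_congr fun x => ?_
    by_cases hx : x ∈ {x ∈ Ico (0 : ℝ) 1 | f' x ≠ 0 ∧ f x = y}
    · rw [indicator_of_mem hx]
      have hxU : x ∈ ⋃ i, s i := by rw [hsU]; exact ⟨hx.1, hx.2.1⟩
      obtain ⟨i, hi⟩ := mem_iUnion.1 hxU
      rw [tsum_eq_single i, indicator_of_mem (show x ∈ s i ∩ f ⁻¹' {y} from ⟨hi, hx.2.2⟩)]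
      intro j hj
      exact indicator_of_notMem (fun hh => disjoint_left.1 (hsd hj) hh.1 hi) _
    · rw [indicator_of_notMem hx, ENNReal.tsum_eq_zero]
      intro i
      refine indicator_of_notMem (fun hh => hx ?_) _
      have hxU : x ∈ ⋃ i, s i := mem_iUnion.2 ⟨i, hh.1⟩
      rw [hsU] at hxU
      exact ⟨hxU.1, hxU.2, hh.2⟩

lemma aux_finite (f f' : ℝ → ℝ) (hf : ∀ x, HasDerivAt f (f' x) x) (y : ℝ)
    (hy : ∀ x, f x = y → f' x ≠ 0) : Set.Finite {x ∈ Ico (0 : ℝ) 1 | f x = y} := by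
  have hfc : Continuous f := continuous_iff_continuousAt.2 fun x => (hf x).continuousAt
  by_contra hinf
  obtain ⟨x, hx, hacc⟩ := Set.Infinite.exists_accPt_of_subset_isCompact hinf
    (isCompact_Icc (a := (0 : ℝ)) (b := 1)) (fun x hx => Ico_subset_Icc_self hx.1)
  have hfreq : ∃ᶠ z in nhdsWithin x {x}ᶜ, z ∈ {x ∈ Ico (0 : ℝ) 1 | f x = y} :=
    accPt_iff_frequently_nhdsNE.1 hacc
  have hcl : x ∈ closure {z | f z = y} := by
    rw [mem_closure_iff_frequently]
    exact (hfreq.filter_mono nhdsWithin_le_nhds).mono fun z hz => hz.2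
  have hxy : f x = y :=
    (isClosed_eq hfc continuous_const : IsClosed {z | f z = y}).closure_subset hcl
  have hev : ∀ᶠ z in nhdsWithin x {x}ᶜ, f z ≠ y := (hf x).eventually_ne (hy x hxy)
  obtain ⟨z, hz1, hz2⟩ := (hfreq.and_eventually hev).exists
  exact hz2 hz1.2

/-- Effective formula for the displacement density: under the
assumptions of a `C¹` circle diffeomorphism lift `Φ`, minimal induced homeomorphism,
`C¹` conjugacy `Γ` with the translation by `ρ`, and critical set of measure zero, the
displacement distribution `μ_Ψ = ψ̄_*μ` (with `μ` the invariant measure of density `Γ'`)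
has a density `D` w.r.t. Lebesgue measure which vanishes outside `Ψ([0,1])` and at
a.e. regular value `y ∈ Ψ([0,1])` is the finite sum `Σ_{Ψ(x)=y, x∈[0,1)} Γ'(x)/|Φ'(x)-1|`. -/
theorem displacement_density_effective_formula
    (Φ Φ' : ℝ → ℝ) (hΦderiv : ∀ x : ℝ, HasDerivAt Φ (Φ' x) x)
    (hΦ'cont : Continuous Φ') (hΦ'pos : ∀ x : ℝ, 0 < Φ' x)
    (hmono : StrictMono Φ) (hbij : Function.Bijective Φ)
    (hlift : ∀ x : ℝ, Φ (x + 1) = Φ x + 1)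
    (ρ : ℝ) (hirr : Irrational ρ)
    (hrot : ∀ x : ℝ, Tendsto (fun n : ℕ => Φ^[n] x / n) atTop (nhds ρ))
    (φ : AddCircle (1 : ℝ) → AddCircle (1 : ℝ))
    (hφ : ∀ x : ℝ, φ (x : AddCircle (1 : ℝ)) = ((Φ x : ℝ) : AddCircle (1 : ℝ)))
    (hminimal : ∀ z : AddCircle (1 : ℝ), Dense (Set.range fun n : ℕ => φ^[n] z))
    (Γ Γ' : ℝ → ℝ) (hΓderiv : ∀ x : ℝ, HasDerivAt Γ (Γ' x) x)
    (hΓ'cont : Continuous Γ') (hΓ'pos : ∀ x : ℝ, 0 < Γ' x)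
    (hΓmono : StrictMono Γ) (hΓbij : Function.Bijective Γ)
    (hΓlift : ∀ x : ℝ, Γ (x + 1) = Γ x + 1)
    (hconj : ∀ x : ℝ, Γ (Φ x) = Γ x + ρ)
    (hC : volume {x ∈ Icc (0 : ℝ) 1 | Φ' x = 1} = 0)
    (ψb : AddCircle (1 : ℝ) → ℝ) (hψcont : Continuous ψb)
    (hψ : ∀ x : ℝ, ψb (x : AddCircle (1 : ℝ)) = Φ x - x) :
    ∃ D : ℝ → ℝ,
      Measure.map ψb
          (Measure.map (fun t : ℝ => (t : AddCircle (1 : ℝ)))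
            ((volume.restrict (Ico (0 : ℝ) 1)).withDensity
              (fun t => ENNReal.ofReal (Γ' t)))) =
        volume.withDensity (fun y => ENNReal.ofReal (D y)) ∧
      (∀ y : ℝ, y ∉ (fun t : ℝ => Φ t - t) '' Icc (0 : ℝ) 1 → D y = 0) ∧
      (∀ᵐ y : ℝ ∂volume, y ∈ (fun t : ℝ => Φ t - t) '' Icc (0 : ℝ) 1 →
        (¬ ∃ x : ℝ, Φ x - x = y ∧ Φ' x = 1) →
        Set.Finite {x ∈ Ico (0 : ℝ) 1 | Φ x - x = y} ∧
        D y = ∑' x : {x ∈ Ico (0 : ℝ) 1 | Φ x - x = y}, Γ' x / |Φ' x - 1|) := by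
  have hf : ∀ x : ℝ, HasDerivAt (fun t : ℝ => Φ t - t) (Φ' x - 1) x :=
    fun x => (hΦderiv x).sub (hasDerivAt_id x)
  have hfc : Continuous (fun t : ℝ => Φ t - t) :=
    continuous_iff_continuousAt.2 fun x => (hf x).continuousAt
  obtain ⟨H, hHm, hHmap, hHy⟩ := aux_density (fun t : ℝ => Φ t - t) (fun x => Φ' x - 1) Γ' hf
    (hΦ'cont.sub continuous_const) hΓ'cont (by simpa only [sub_eq_zero] using hC)
  have hfin : ∫⁻ y, H y ≠ ⊤ := by
    have h1 : (volume.withDensity H) univ = ∫⁻ y, H y := by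
      rw [withDensity_apply _ MeasurableSet.univ, Measure.restrict_univ]
    rw [← h1, ← hHmap, Measure.map_apply hfc.measurable MeasurableSet.univ, preimage_univ,
      withDensity_apply _ MeasurableSet.univ, Measure.restrict_univ]
    have hint : IntegrableOn Γ' (Ico (0 : ℝ) 1) volume :=
      (hΓ'cont.integrableOn_Icc (a := 0) (b := 1)).mono_set Ico_subset_Icc_self
    exact (Integrable.lintegral_lt_top hint).ne
  have hlt : ∀ᵐ y, H y < ⊤ := ae_lt_top hHm hfin
  refine ⟨fun y => (H y).toReal, ?_, ?_, ?_⟩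
  · have hcoe : Measurable (fun t : ℝ => (t : AddCircle (1 : ℝ))) :=
      (AddCircle.continuous_mk' (1 : ℝ)).measurable
    rw [Measure.map_map hψcont.measurable hcoe]
    have hcomp : (ψb ∘ fun t : ℝ => (t : AddCircle (1 : ℝ))) = fun t : ℝ => Φ t - t :=
      funext hψ
    rw [hcomp, hHmap]
    refine withDensity_congr_ae ?_
    filter_upwards [hlt] with y hy
    exact (ENNReal.ofReal_toReal hy.ne).symm
  · intro y hy
    have : H y = 0 := by
      rw [hHy, ENNReal.tsum_eq_zero]
      intro x
      exact indicator_of_notMem (fun hx => hy ⟨x, Ico_subset_Icc_self hx.1, hx.2.2⟩) _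
    simp [this]
  · refine Eventually.of_forall fun y _ hreg => ?_
    have hreg' : ∀ x, Φ x - x = y → Φ' x - 1 ≠ 0 :=
      fun x hx h0 => hreg ⟨x, hx, sub_eq_zero.1 h0⟩
    refine ⟨aux_finite (fun t : ℝ => Φ t - t) (fun x => Φ' x - 1) hf y hreg', ?_⟩
    have hset : {x ∈ Ico (0 : ℝ) 1 | Φ' x - 1 ≠ 0 ∧ Φ x - x = y} =
        {x ∈ Ico (0 : ℝ) 1 | Φ x - x = y} := by
      ext x
      exact ⟨fun hx => ⟨hx.1, hx.2.2⟩, fun hx => ⟨hx.1, hreg' x hx.2, hx.2⟩⟩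
    have h2 := hHy y
    rw [hset, ← tsum_subtype] at h2
    change (H y).toReal = _
    rw [h2, ENNReal.tsum_toReal_eq (fun _ => ENNReal.ofReal_ne_top)]
    refine tsum_congr fun x => ?_
    exact ENNReal.toReal_ofReal (div_nonneg (hΓ'pos _).le (abs_nonneg _))
end

section
/- Uniform Birkhoff frequencies of displacements: Let Φ be a lift of an orientation-preserving circle homeomorphism with irrational rotation number, let μ be the unique invariant Borel probability measure of the induced homeomorphism φ of ℝ/ℤ, and let μ_Ψ = ψ̄_*μ be the displacement distribution. Then for every Borel set A ⊆ ℝ whose topological boundary satisfies μ_Ψ(∂A) = 0, the frequencies (1/n)·#{0 ≤ i ≤ n−1 : Φ^{i+1}(x) − Φ^{i}(x) ∈ A} converge to μ_Ψ(A) as n → ∞, uniformly in x ∈ ℝ. -/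
open Filter Set MeasureTheory

/-- the measurable section of the circle with values in `[0,1)` -/
noncomputable def circSec (p : AddCircle (1 : ℝ)) : ℝ :=
  (AddCircle.measurableEquivIco 1 0 p : ℝ)

lemma circSec_meas : Measurable circSec :=
  measurable_subtype_coe.comp (AddCircle.measurableEquivIco 1 0).measurable

lemma circSec_mem (p : AddCircle (1 : ℝ)) : 0 ≤ circSec p ∧ circSec p < 1 := by
  have h := (AddCircle.measurableEquivIco 1 0 p).2
  simpa [circSec] using h

lemma circSec_coe (p : AddCircle (1 : ℝ)) : ((circSec p : ℝ) : AddCircle (1 : ℝ)) = p :=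
  AddCircle.coe_equivIco

lemma circ_coe_eq {a b : ℝ} (h : (a : AddCircle (1 : ℝ)) = b) : ∃ k : ℤ, a = b + k := by
  rw [QuotientAddGroup.eq, AddSubgroup.mem_zmultiples_iff] at h
  obtain ⟨k, hk⟩ := h
  refine ⟨-k, ?_⟩
  simp at hk
  push_cast
  linarith

lemma lift_int (Φ : ℝ → ℝ) (hlift : ∀ x : ℝ, Φ (x + 1) = Φ x + 1) (x : ℝ) (k : ℤ) :
    Φ (x + k) = Φ x + k := by
  induction k using Int.induction_on with
  | zero => simp
  | succ i ih => push_cast at *; rw [← add_assoc, hlift, ih]; ring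
  | pred i ih =>
    push_cast at *
    have := hlift (x + (-i - 1))
    rw [show x + (-(i : ℝ) - 1) + 1 = x + -i by ring, ih] at this
    linarith

lemma ceil_lift (Φ : ℝ → ℝ) (hmono : StrictMono Φ) (hlift : ∀ x : ℝ, Φ (x + 1) = Φ x + 1)
    (t y : ℝ) : ⌈Φ y - Φ t⌉ = ⌈y - t⌉ := by
  rw [Int.ceil_eq_iff]
  have h1 := Int.ceil_lt_add_one (y - t)
  have h2 := Int.le_ceil (y - t)
  set n := ⌈y - t⌉
  constructor
  · have : Φ (t + ((n - 1 : ℤ) : ℝ)) < Φ y := hmono (by push_cast; linarith)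
    rw [lift_int Φ hlift] at this
    push_cast at this
    linarith
  · have : Φ y ≤ Φ (t + (n : ℝ)) := hmono.monotone (by linarith)
    rw [lift_int Φ hlift] at this
    linarith

/-- cumulative height function of a measure on the circle -/
noncomputable def circH (μ : Measure (AddCircle (1 : ℝ))) (y : ℝ) : ℝ :=
  ∫ p, ((⌈y - circSec p⌉ : ℤ) : ℝ) ∂μ

lemma circH_meas (y : ℝ) : Measurable (fun p => ((⌈y - circSec p⌉ : ℤ) : ℝ)) := by
  have : Measurable (fun p => ⌈y - circSec p⌉) :=
    Int.measurable_ceil.comp (measurable_const.sub circSec_meas)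
  exact (measurable_from_top (f := fun z : ℤ => (z : ℝ))).comp this

lemma circH_bd (y : ℝ) (p : AddCircle (1 : ℝ)) :
    y - 1 ≤ ((⌈y - circSec p⌉ : ℤ) : ℝ) ∧ ((⌈y - circSec p⌉ : ℤ) : ℝ) ≤ y + 1 := by
  have h1 := Int.ceil_lt_add_one (y - circSec p)
  have h2 := Int.le_ceil (y - circSec p)
  have := circSec_mem p
  constructor <;> linarith

lemma circH_int (μ : Measure (AddCircle (1 : ℝ))) [IsProbabilityMeasure μ] (y : ℝ) :
    Integrable (fun p => ((⌈y - circSec p⌉ : ℤ) : ℝ)) μ := by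
  refine Integrable.of_bound (circH_meas y).aestronglyMeasurable (|y| + 1) (ae_of_all _ fun p => ?_)
  have := circH_bd y p
  rw [Real.norm_eq_abs, abs_le]
  have h1 := neg_abs_le y
  have h2 := le_abs_self y
  constructor <;> linarith

lemma circH_mono (μ : Measure (AddCircle (1 : ℝ))) [IsProbabilityMeasure μ] :
    Monotone (circH μ) := by
  intro x y hxy
  refine integral_mono (circH_int μ x) (circH_int μ y) fun p => ?_
  have : ⌈x - circSec p⌉ ≤ ⌈y - circSec p⌉ := Int.ceil_mono (by linarith)
  exact Int.cast_le.2 this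

lemma circH_add (μ : Measure (AddCircle (1 : ℝ))) [IsProbabilityMeasure μ] (y : ℝ) (k : ℤ) :
    circH μ (y + k) = circH μ y + k := by
  have : ∀ p, ((⌈y + k - circSec p⌉ : ℤ) : ℝ) = ((⌈y - circSec p⌉ : ℤ) : ℝ) + k := by
    intro p
    rw [show y + k - circSec p = y - circSec p + k by ring, Int.ceil_add_intCast]
    push_cast; rfl
  unfold circH
  simp_rw [this]
  rw [integral_add (circH_int μ y) (integrable_const _)]
  simp

lemma circH_near (μ : Measure (AddCircle (1 : ℝ))) [IsProbabilityMeasure μ] (y : ℝ) :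
    |circH μ y - y| ≤ 1 := by
  have h1 : ∫ p, (y - 1) ∂μ ≤ circH μ y :=
    integral_mono (integrable_const _) (circH_int μ y) fun p => (circH_bd y p).1
  have h2 : circH μ y ≤ ∫ p, (y + 1) ∂μ :=
    integral_mono (circH_int μ y) (integrable_const _) fun p => (circH_bd y p).2
  simp at h1 h2
  rw [abs_le]
  constructor <;> linarith

lemma circH_diff (Φ : ℝ → ℝ) (hmono : StrictMono Φ) (hlift : ∀ x : ℝ, Φ (x + 1) = Φ x + 1)
    (φ : AddCircle (1 : ℝ) → AddCircle (1 : ℝ)) (hφc : Measurable φ)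
    (hφ : ∀ x : ℝ, φ (x : AddCircle (1 : ℝ)) = ((Φ x : ℝ) : AddCircle (1 : ℝ)))
    (μ : Measure (AddCircle (1 : ℝ))) [IsProbabilityMeasure μ]
    (hinv : Measure.map φ μ = μ) (x y : ℝ) :
    circH μ (Φ y) - circH μ (Φ x) = circH μ y - circH μ x := by
  unfold circH
  rw [← integral_sub (circH_int μ _) (circH_int μ _), ← integral_sub (circH_int μ _) (circH_int μ _)]
  have : ∫ p, (((⌈Φ y - circSec p⌉ : ℤ) : ℝ) - ((⌈Φ x - circSec p⌉ : ℤ) : ℝ)) ∂μ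
      = ∫ p, (((⌈Φ y - circSec p⌉ : ℤ) : ℝ) - ((⌈Φ x - circSec p⌉ : ℤ) : ℝ)) ∂(Measure.map φ μ) := by
    rw [hinv]
  rw [this, integral_map hφc.aemeasurable
    (f := fun p => ((⌈Φ y - circSec p⌉ : ℤ) : ℝ) - ((⌈Φ x - circSec p⌉ : ℤ) : ℝ))
    ((circH_meas _).sub (circH_meas _)).aestronglyMeasurable]
  refine integral_congr_ae (ae_of_all _ fun p => ?_)
  have h1 : ((circSec (φ p) : ℝ) : AddCircle (1 : ℝ)) = ((Φ (circSec p) : ℝ) : AddCircle (1 : ℝ)) := by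
    rw [circSec_coe, ← hφ, circSec_coe]
  obtain ⟨k, hk⟩ := circ_coe_eq h1
  have key : ∀ z, ⌈Φ z - circSec (φ p)⌉ = ⌈z - circSec p⌉ - k := by
    intro z
    rw [hk, ← sub_sub, Int.ceil_sub_intCast, ceil_lift Φ hmono hlift]
  simp only [key]
  push_cast
  ring

lemma circH_iter (Φ : ℝ → ℝ) (c : ℝ) (h : ℝ → ℝ) (hc : ∀ x, h (Φ x) = h x + c) (n : ℕ) (x : ℝ) :
    h (Φ^[n] x) = h x + n * c := by
  induction n with
  | zero => simp
  | succ n ih => rw [Function.iterate_succ_apply', hc, ih]; push_cast; ring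

lemma circH_rot (Φ : ℝ → ℝ) (hmono : StrictMono Φ) (hlift : ∀ x : ℝ, Φ (x + 1) = Φ x + 1)
    (ρ : ℝ) (hrot : ∀ x : ℝ, Tendsto (fun n : ℕ => Φ^[n] x / n) atTop (nhds ρ))
    (φ : AddCircle (1 : ℝ) → AddCircle (1 : ℝ)) (hφc : Measurable φ)
    (hφ : ∀ x : ℝ, φ (x : AddCircle (1 : ℝ)) = ((Φ x : ℝ) : AddCircle (1 : ℝ)))
    (μ : Measure (AddCircle (1 : ℝ))) [IsProbabilityMeasure μ]
    (hinv : Measure.map φ μ = μ) (x : ℝ) :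
    circH μ (Φ x) = circH μ x + ρ := by
  set c := circH μ (Φ 0) - circH μ 0 with hcdef
  have hc : ∀ x, circH μ (Φ x) = circH μ x + c := by
    intro x
    have := circH_diff Φ hmono hlift φ hφc hφ μ hinv 0 x
    linarith
  have hit := circH_iter Φ c _ hc
  have h1 : Tendsto (fun n : ℕ => Φ^[n] 0 / n - c) atTop (nhds 0) := by
    refine squeeze_zero_norm' (a := fun n : ℕ => (1 + |circH μ 0|) / n) ?_
      (tendsto_const_div_atTop_nhds_zero_nat _)
    filter_upwards [eventually_gt_atTop 0] with n hn
    have hn' : (0 : ℝ) < n := by exact_mod_cast hn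
    have e : Φ^[n] 0 / n - c = (circH μ 0 - (circH μ (Φ^[n] 0) - Φ^[n] 0)) / n := by
      rw [hit]; field_simp; ring
    rw [e, norm_div, Real.norm_eq_abs, Real.norm_eq_abs, abs_of_pos hn']
    gcongr
    have := circH_near μ (Φ^[n] 0)
    have := abs_sub (circH μ 0) (circH μ (Φ^[n] 0) - Φ^[n] 0)
    linarith
  have h2 := (hrot 0).sub_const c
  have := tendsto_nhds_unique h1 h2
  rw [hc]; linarith

lemma height_le (Φ : ℝ → ℝ) (ρ : ℝ) (hirr : Irrational ρ) (h g : ℝ → ℝ)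
    (hm : Monotone h) (gm : Monotone g)
    (hk : ∀ (x : ℝ) (k : ℤ), h (x + k) = h x + k) (gk : ∀ (x : ℝ) (k : ℤ), g (x + k) = g x + k)
    (hr : ∀ x, h (Φ x) = h x + ρ) (gr : ∀ x, g (Φ x) = g x + ρ) (x y : ℝ) :
    g y - g x ≤ h y - h x := by
  by_contra! hlt
  have hd : Dense (AddSubgroup.closure {ρ, (1 : ℝ)} : Set ℝ) := by
    rw [dense_addSubgroupClosure_pair_iff]; simpa using hirr
  obtain ⟨z, hz, hz1, hz2⟩ := hd.exists_between hlt
  rw [SetLike.mem_coe, AddSubgroup.mem_closure_pair] at hz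
  obtain ⟨i, j, rfl⟩ := hz
  simp only [zsmul_eq_mul, mul_one] at hz1 hz2
  have hi := circH_iter Φ ρ h hr
  have gi := circH_iter Φ ρ g gr
  obtain ⟨n, rfl | rfl⟩ := i.eq_nat_or_neg
  · push_cast at hz1 hz2
    rcases le_total (Φ^[n] x + (j : ℝ)) y with hle | hle
    · have := hm hle
      rw [hk, hi] at this
      linarith
    · have := gm hle
      rw [gk, gi] at this
      linarith
  · push_cast at hz1 hz2
    rcases le_total (Φ^[n] y) (x + (j : ℝ)) with hle | hle
    · have := gm hle
      rw [gk, gi] at this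
      linarith
    · have := hm hle
      rw [hk, hi] at this
      linarith

lemma circH_Ici (μ : Measure (AddCircle (1 : ℝ))) [IsProbabilityMeasure μ] (y : ℝ)
    (h0 : 0 ≤ y) (h1 : y ≤ 1) :
    μ.real (circSec ⁻¹' Ici y) = 1 - (circH μ y - circH μ 0) := by
  have hms : MeasurableSet (circSec ⁻¹' Ici y) := circSec_meas measurableSet_Ici
  unfold circH
  rw [← integral_sub (circH_int μ _) (circH_int μ _), ← integral_indicator_one hms]
  have e1 : (1 : ℝ) = ∫ p, (1 : ℝ) ∂μ := by simp
  refine Eq.trans ?_ (congrArg (fun t : ℝ => t - ∫ p, (((⌈y - circSec p⌉ : ℤ) : ℝ)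
    - ((⌈0 - circSec p⌉ : ℤ) : ℝ)) ∂μ) e1.symm)
  have hi : Integrable (fun p => ((⌈y - circSec p⌉ : ℤ) : ℝ) - ((⌈0 - circSec p⌉ : ℤ) : ℝ)) μ :=
    (circH_int μ _).sub (circH_int μ _)
  rw [← integral_sub (integrable_const _) hi]
  refine integral_congr_ae (ae_of_all _ fun p => ?_)
  have hp := circSec_mem p
  have c0 : ⌈0 - circSec p⌉ = 0 := by
    rw [Int.ceil_eq_iff]; push_cast; constructor <;> linarith
  by_cases hy : y ≤ circSec p
  · have c1 : ⌈y - circSec p⌉ = 0 := by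
      rw [Int.ceil_eq_iff]; push_cast; constructor <;> linarith
    simp [indicator, hy, c0, c1, -zero_sub]
  · have c1 : ⌈y - circSec p⌉ = 1 := by
      rw [Int.ceil_eq_iff]; push_cast; constructor <;> linarith
    simp [indicator, hy, c0, c1, -zero_sub]

lemma invariant_unique (Φ : ℝ → ℝ) (hmono : StrictMono Φ) (hlift : ∀ x : ℝ, Φ (x + 1) = Φ x + 1)
    (ρ : ℝ) (hirr : Irrational ρ)
    (hrot : ∀ x : ℝ, Tendsto (fun n : ℕ => Φ^[n] x / n) atTop (nhds ρ))
    (φ : AddCircle (1 : ℝ) → AddCircle (1 : ℝ)) (hφc : Measurable φ)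
    (hφ : ∀ x : ℝ, φ (x : AddCircle (1 : ℝ)) = ((Φ x : ℝ) : AddCircle (1 : ℝ)))
    (μ ν : Measure (AddCircle (1 : ℝ))) [IsProbabilityMeasure μ] [IsProbabilityMeasure ν]
    (hμ : Measure.map φ μ = μ) (hν : Measure.map φ ν = ν) : μ = ν := by
  have rμ := circH_rot Φ hmono hlift ρ hrot φ hφc hφ μ hμ
  have rν := circH_rot Φ hmono hlift ρ hrot φ hφc hφ ν hν
  have hdiff : ∀ x y, circH μ y - circH μ x = circH ν y - circH ν x := fun x y =>
    le_antisymm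
      (height_le Φ ρ hirr _ _ (circH_mono ν) (circH_mono μ) (circH_add ν) (circH_add μ) rν rμ x y)
      (height_le Φ ρ hirr _ _ (circH_mono μ) (circH_mono ν) (circH_add μ) (circH_add ν) rμ rν x y)
  have hmap : Measure.map circSec μ = Measure.map circSec ν := by
    have := Measure.isProbabilityMeasure_map (μ := μ) circSec_meas.aemeasurable
    have := Measure.isProbabilityMeasure_map (μ := ν) circSec_meas.aemeasurable
    refine Measure.ext_of_Ici _ _ fun y => ?_
    rw [Measure.map_apply circSec_meas measurableSet_Ici,
      Measure.map_apply circSec_meas measurableSet_Ici]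
    rcases lt_or_ge y 0 with hy | hy
    · have : circSec ⁻¹' Ici y = univ :=
        eq_univ_of_forall fun p => hy.le.trans (circSec_mem p).1
      rw [this]; simp
    rcases lt_or_ge 1 y with hy1 | hy1
    · have : circSec ⁻¹' Ici y = ∅ :=
        eq_empty_of_forall_notMem fun p hp => by
          have h1 := (circSec_mem p).2
          have h2 : y ≤ circSec p := hp
          linarith
      rw [this]; simp
    have := circH_Ici μ y hy hy1
    rw [hdiff 0 y, ← circH_Ici ν y hy hy1] at this
    exact (measureReal_eq_measureReal_iff).1 this
  have hcoe : Measurable (fun x : ℝ => (x : AddCircle (1 : ℝ))) :=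
    (AddCircle.continuous_mk' 1).measurable
  have hid : ∀ m : Measure (AddCircle (1 : ℝ)),
      Measure.map (fun x : ℝ => (x : AddCircle (1 : ℝ))) (Measure.map circSec m) = m := by
    intro m
    rw [Measure.map_map hcoe circSec_meas]
    have : (fun x : ℝ => (x : AddCircle (1 : ℝ))) ∘ circSec = id := funext circSec_coe
    rw [this, Measure.map_id]
  rw [← hid μ, hmap, hid ν]

/-- empirical measures -/
lemma exists_empirical (φ : AddCircle (1 : ℝ) → AddCircle (1 : ℝ)) (q : ℕ × ℝ) :
    ∃ P : ProbabilityMeasure (AddCircle (1 : ℝ)), q.1 ≠ 0 → (P : Measure (AddCircle (1 : ℝ))) =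
      (q.1 : ENNReal)⁻¹ • ∑ i ∈ Finset.range q.1, Measure.dirac (φ^[i] (q.2 : AddCircle (1 : ℝ))) := by
  by_cases h : q.1 = 0
  · exact ⟨⟨Measure.dirac 0, inferInstance⟩, fun h' => absurd h h'⟩
  · refine ⟨⟨(q.1 : ENNReal)⁻¹ • ∑ i ∈ Finset.range q.1,
      Measure.dirac (φ^[i] (q.2 : AddCircle (1 : ℝ))), ⟨?_⟩⟩, fun _ => rfl⟩
    simp [Measure.finsetSum_apply]
    exact ENNReal.inv_mul_cancel (by exact_mod_cast h) (ENNReal.natCast_ne_top _)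

lemma empirical_tendsto (φ : AddCircle (1 : ℝ) → AddCircle (1 : ℝ)) (hφc : Continuous φ)
    (μ : ProbabilityMeasure (AddCircle (1 : ℝ)))
    (huniq : ∀ ν : ProbabilityMeasure (AddCircle (1 : ℝ)),
      Measure.map φ (ν : Measure (AddCircle (1 : ℝ))) = ν → ν = μ)
    (E : ℕ × ℝ → ProbabilityMeasure (AddCircle (1 : ℝ)))
    (hE : ∀ q, q.1 ≠ 0 → (E q : Measure (AddCircle (1 : ℝ))) =
      (q.1 : ENNReal)⁻¹ • ∑ i ∈ Finset.range q.1, Measure.dirac (φ^[i] (q.2 : AddCircle (1 : ℝ)))) :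
    Tendsto E (atTop ×ˢ ⊤) (nhds μ) := by
  rw [tendsto_iff_ultrafilter]
  intro U hU
  obtain ⟨ν, -, hν⟩ := isCompact_univ.ultrafilter_le_nhds (U.map E) (by simp)
  have hν' : Tendsto E U (nhds ν) := hν
  have hfst : Tendsto Prod.fst (U : Filter (ℕ × ℝ)) atTop := tendsto_fst.mono_left hU
  suffices hinv : Measure.map φ (ν : Measure (AddCircle (1 : ℝ))) = ν by
    rw [← huniq ν hinv]; exact hν'
  have := Measure.isProbabilityMeasure_map (μ := (ν : Measure (AddCircle (1 : ℝ))))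
    hφc.measurable.aemeasurable
  refine ext_of_forall_integral_eq_of_IsFiniteMeasure fun f => ?_
  rw [integral_map hφc.measurable.aemeasurable f.continuous.aestronglyMeasurable]
  rw [ProbabilityMeasure.tendsto_iff_forall_integral_tendsto] at hν'
  have h1 := hν' f
  have h2 := hν' (f.compContinuous ⟨φ, hφc⟩)
  have h3 := h2.sub h1
  have hint : ∀ (g : BoundedContinuousFunction (AddCircle (1 : ℝ)) ℝ) (q : ℕ × ℝ), q.1 ≠ 0 →
      ∫ p, g p ∂(E q : Measure (AddCircle (1 : ℝ))) =
        (q.1 : ℝ)⁻¹ * ∑ i ∈ Finset.range q.1, g (φ^[i] (q.2 : AddCircle (1 : ℝ))) := by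
    intro g q hq
    rw [hE q hq, integral_smul_measure, integral_finsetSum_measure]
    · simp
    · intro i _
      exact g.integrable _
  have h4 : Tendsto (fun q => ∫ p, f.compContinuous ⟨φ, hφc⟩ p ∂(E q : Measure (AddCircle (1 : ℝ)))
      - ∫ p, f p ∂(E q : Measure (AddCircle (1 : ℝ)))) U (nhds 0) := by
    refine squeeze_zero_norm' (a := fun q : ℕ × ℝ => (2 * ‖f‖) / (q.1 : ℝ)) ?_
      ((tendsto_const_div_atTop_nhds_zero_nat _).comp hfst)
    filter_upwards [hfst.eventually (eventually_gt_atTop 0)] with q hq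
    have hq' : (0 : ℝ) < q.1 := by exact_mod_cast hq
    rw [hint _ q hq.ne', hint _ q hq.ne', ← mul_sub, ← Finset.sum_sub_distrib]
    have : ∑ i ∈ Finset.range q.1, ((f.compContinuous ⟨φ, hφc⟩) (φ^[i] (q.2 : AddCircle (1 : ℝ)))
        - f (φ^[i] (q.2 : AddCircle (1 : ℝ)))) = f (φ^[q.1] (q.2 : AddCircle (1 : ℝ))) - f q.2 := by
      have := Finset.sum_range_sub (fun i => f (φ^[i] (q.2 : AddCircle (1 : ℝ)))) q.1
      simpa [Function.iterate_succ_apply'] using this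
    rw [this, norm_mul, norm_inv, Real.norm_eq_abs, abs_of_pos hq', inv_mul_eq_div]
    gcongr
    calc _ ≤ ‖f (φ^[q.1] (q.2 : AddCircle (1 : ℝ)))‖ + ‖f q.2‖ := norm_sub_le _ _
      _ ≤ ‖f‖ + ‖f‖ := add_le_add (f.norm_coe_le_norm _) (f.norm_coe_le_norm _)
      _ = _ := by ring
  have := tendsto_nhds_unique h3 h4
  simpa [sub_eq_zero] using this


/-- Uniform Birkhoff frequencies of displacements: for a circle
homeomorphism with irrational rotation number (unique invariant measure `μ`,
displacement distribution `μ_Ψ = ψ̄_*μ`) and any Borel set `A ⊆ ℝ` with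
`μ_Ψ(∂A) = 0`, the frequency of visits of the displacements `Φ^[i+1] x - Φ^[i] x`
to `A` converges to `μ_Ψ(A)` uniformly in `x`. -/
theorem displacement_frequencies_uniform
    (Φ : ℝ → ℝ) (hcont : Continuous Φ) (hmono : StrictMono Φ)
    (hbij : Function.Bijective Φ) (hlift : ∀ x : ℝ, Φ (x + 1) = Φ x + 1)
    (ρ : ℝ) (hirr : Irrational ρ)
    (hrot : ∀ x : ℝ, Tendsto (fun n : ℕ => Φ^[n] x / n) atTop (nhds ρ))
    (φ : AddCircle (1 : ℝ) → AddCircle (1 : ℝ))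
    (hφ : ∀ x : ℝ, φ (x : AddCircle (1 : ℝ)) = ((Φ x : ℝ) : AddCircle (1 : ℝ)))
    (μ : Measure (AddCircle (1 : ℝ))) (hprob : IsProbabilityMeasure μ)
    (hinv : Measure.map φ μ = μ)
    (ψb : AddCircle (1 : ℝ) → ℝ) (hψcont : Continuous ψb)
    (hψ : ∀ x : ℝ, ψb (x : AddCircle (1 : ℝ)) = Φ x - x)
    (A : Set ℝ) (hA : MeasurableSet A)
    (hbd : Measure.map ψb μ (frontier A) = 0) :
    TendstoUniformly
      (fun n : ℕ => fun x : ℝ =>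
        (∑ i ∈ Finset.range n, A.indicator (fun _ => (1 : ℝ)) (Φ^[i + 1] x - Φ^[i] x)) / n)
      (fun _ : ℝ => (Measure.map ψb μ A).toReal) atTop := by

  have hφc : Continuous φ := by
    have hq : Topology.IsQuotientMap (fun x : ℝ => (x : AddCircle (1 : ℝ))) :=
      isQuotientMap_quotient_mk'
    rw [hq.continuous_iff]
    have : φ ∘ (fun x : ℝ => (x : AddCircle (1 : ℝ))) = fun x => ((Φ x : ℝ) : AddCircle (1 : ℝ)) :=
      funext hφ
    rw [this]
    exact (AddCircle.continuous_mk' 1).comp hcont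
  choose E hE using exists_empirical φ
  have hT := empirical_tendsto φ hφc ⟨μ, hprob⟩ (fun ν hν => Subtype.ext
    (invariant_unique Φ hmono hlift ρ hirr hrot φ hφc.measurable hφ ν μ hν hinv)) E hE
  have hB : MeasurableSet (ψb ⁻¹' A) := hψcont.measurable hA
  have hfr : μ (frontier (ψb ⁻¹' A)) = 0 := by
    rw [Measure.map_apply hψcont.measurable isClosed_frontier.measurableSet] at hbd
    exact measure_mono_null (hψcont.frontier_preimage_subset A) hbd
  have hP := ProbabilityMeasure.tendsto_measure_of_null_frontier_of_tendsto' hT hfr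
  have hP2 := (ENNReal.tendsto_toReal (measure_ne_top μ (ψb ⁻¹' A))).comp hP
  rw [Measure.map_apply hψcont.measurable hA, ← tendsto_prod_top_iff]
  refine hP2.congr' ?_
  have hfst : Tendsto Prod.fst (atTop ×ˢ (⊤ : Filter ℝ) : Filter (ℕ × ℝ)) atTop := tendsto_fst
  filter_upwards [hfst.eventually (eventually_gt_atTop 0)] with q hq
  have hit : ∀ i, φ^[i] (q.2 : AddCircle (1 : ℝ)) = ((Φ^[i] q.2 : ℝ) : AddCircle (1 : ℝ)) := by
    intro i
    induction i with
    | zero => rfl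
    | succ i ih => rw [Function.iterate_succ_apply', ih, hφ, Function.iterate_succ_apply']
  simp only [Function.comp_apply, hE q hq.ne', Measure.smul_apply, Measure.finsetSum_apply,
    Measure.dirac_apply' _ hB, smul_eq_mul, ENNReal.toReal_mul, ENNReal.toReal_inv,
    ENNReal.toReal_natCast]
  rw [ENNReal.toReal_sum (by intro i _; simp only [indicator]; split_ifs <;> simp), inv_mul_eq_div]
  congr 1
  refine Finset.sum_congr rfl fun i _ => ?_
  have hmem : φ^[i] (q.2 : AddCircle (1 : ℝ)) ∈ ψb ⁻¹' A ↔ Φ^[i + 1] q.2 - Φ^[i] q.2 ∈ A := by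
    rw [mem_preimage, hit, hψ, Function.iterate_succ_apply']
  by_cases hm : Φ^[i + 1] q.2 - Φ^[i] q.2 ∈ A
  · rw [indicator_of_mem hm, indicator_of_mem (hmem.2 hm)]; simp
  · rw [indicator_of_notMem hm, indicator_of_notMem (fun h => hm (hmem.1 h))]; simp
end

section
/- The rotation number is the mean displacement: Let Φ be a lift of an orientation-preserving circle homeomorphism with irrational rotation number ρ(Φ), and let μ be a Borel probability measure on ℝ/ℤ invariant under the induced homeomorphism φ. Then ∫_{ℝ/ℤ} ψ̄ dμ = ρ(Φ), where ψ̄ is the displacement map of Φ. -/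
open Filter MeasureTheory

/-- The rotation number is the mean displacement: for a lift `Φ` of a
circle homeomorphism with irrational rotation number `ρ` and any invariant Borel
probability measure `μ` of the induced homeomorphism `φ`, the integral of the
displacement map `ψ̄` with respect to `μ` equals `ρ`. -/
theorem rotation_number_eq_mean_displacement
    (Φ : ℝ → ℝ) (hcont : Continuous Φ) (hmono : StrictMono Φ)
    (hbij : Function.Bijective Φ) (hlift : ∀ x : ℝ, Φ (x + 1) = Φ x + 1)
    (ρ : ℝ) (hirr : Irrational ρ)
    (hrot : ∀ x : ℝ, Tendsto (fun n : ℕ => Φ^[n] x / n) atTop (nhds ρ))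
    (φ : AddCircle (1 : ℝ) → AddCircle (1 : ℝ))
    (hφ : ∀ x : ℝ, φ (x : AddCircle (1 : ℝ)) = ((Φ x : ℝ) : AddCircle (1 : ℝ)))
    (μ : Measure (AddCircle (1 : ℝ))) (hprob : IsProbabilityMeasure μ)
    (hinv : Measure.map φ μ = μ)
    (ψb : AddCircle (1 : ℝ) → ℝ) (hψcont : Continuous ψb)
    (hψ : ∀ x : ℝ, ψb (x : AddCircle (1 : ℝ)) = Φ x - x) :
    ∫ z, ψb z ∂μ = ρ := by
  have hφc : Continuous φ := by
    have h : Continuous (fun x : ℝ => φ (x : AddCircle (1 : ℝ))) := by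
      simp only [hφ]
      exact (AddCircle.continuous_mk' 1).comp hcont
    exact (QuotientAddGroup.isQuotientMap_mk _).continuous_iff.mpr h
  have hmp : MeasurePreserving φ μ μ := ⟨hφc.measurable, hinv⟩
  let f : CircleDeg1Lift := ⟨⟨Φ, hmono.monotone⟩, hlift⟩
  have hf : ∀ x, f x = Φ x := fun _ => rfl
  have hτ : f.translationNumber = ρ := by
    apply f.translationNumber_eq_of_tendsto₀
    exact hrot 0
  have hiter : ∀ (n : ℕ) (x : ℝ), φ^[n] (x : AddCircle (1 : ℝ)) = ((Φ^[n] x : ℝ) : AddCircle (1 : ℝ)) := by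
    intro n
    induction n with
    | zero => intro x; rfl
    | succ n ih => intro x; rw [Function.iterate_succ_apply, hφ, ih, Function.iterate_succ_apply]
  have hsum : ∀ (n : ℕ) (x : ℝ),
      ∑ k ∈ Finset.range n, ψb (φ^[k] (x : AddCircle (1 : ℝ))) = Φ^[n] x - x := by
    intro n x
    induction n with
    | zero => simp
    | succ n ih =>
      rw [Finset.sum_range_succ, ih, hiter, hψ, Function.iterate_succ_apply']
      ring
  have hbound : ∀ (n : ℕ) (x : ℝ), |Φ^[n] x - x - n * ρ| ≤ 1 := by
    intro n x
    have h1 := (f ^ n).floor_sub_le_translationNumber x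
    have h2 := (f ^ n).translationNumber_le_ceil_sub x
    rw [CircleDeg1Lift.translationNumber_pow, hτ, CircleDeg1Lift.coe_pow] at h1 h2
    have h3 := Int.lt_floor_add_one (f^[n] x - x)
    have h4 := Int.ceil_lt_add_one (f^[n] x - x)
    have h5 : f^[n] x = Φ^[n] x := rfl
    rw [h5] at h1 h2 h3 h4
    rw [abs_le]
    constructor <;> linarith
  have hint : ∀ g : AddCircle (1 : ℝ) → ℝ, Continuous g → Integrable g μ := by
    intro g hg
    have : Fact ((0 : ℝ) < 1) := ⟨one_pos⟩
    exact hg.integrable_of_hasCompactSupport (HasCompactSupport.of_compactSpace g)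
  have hI : ∀ k : ℕ, ∫ z, ψb (φ^[k] z) ∂μ = ∫ z, ψb z ∂μ := by
    intro k
    have hk := hmp.iterate k
    have h := integral_map (μ := μ) hk.measurable.aemeasurable
      (hψcont.aestronglyMeasurable (μ := Measure.map φ^[k] μ))
    rw [hk.map_eq] at h
    exact h.symm
  have hn : ∀ n : ℕ, |(n : ℝ) * ((∫ z, ψb z ∂μ) - ρ)| ≤ 1 := by
    intro n
    have hi : ∀ k ∈ Finset.range n, Integrable (fun z => ψb (φ^[k] z)) μ :=
      fun k _ => hint _ (hψcont.comp (hφc.iterate k))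
    have e : ∫ z, (∑ k ∈ Finset.range n, ψb (φ^[k] z) - n * ρ) ∂μ
        = (n : ℝ) * ((∫ z, ψb z ∂μ) - ρ) := by
      rw [integral_sub (integrable_finsetSum _ hi) (integrable_const _), integral_finsetSum _ hi]
      simp only [hI]
      simp
      ring
    rw [← e]
    have := norm_integral_le_of_norm_le_const (μ := μ) (C := 1)
      (f := fun z => ∑ k ∈ Finset.range n, ψb (φ^[k] z) - n * ρ) (Eventually.of_forall (by
        intro z
        induction z using QuotientAddGroup.induction_on with
        | H x =>
          rw [Real.norm_eq_abs]
          have := hbound n x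
          rw [← hsum n x] at this
          exact this))
    simpa using this
  by_contra hne
  have hpos : 0 < |(∫ z, ψb z ∂μ) - ρ| := abs_pos.mpr (sub_ne_zero.mpr hne)
  obtain ⟨n, hn'⟩ := exists_nat_gt (1 / |(∫ z, ψb z ∂μ) - ρ|)
  have h := hn n
  rw [abs_mul, Nat.abs_cast] at h
  rw [div_lt_iff₀ hpos] at hn'
  linarith
end
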